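/- arXiv:1402.4399 — 5 statements merged into one kernel-verified Lean document; each statement's English description precedes it below -/
import Mathlib

section
/- (Decay of non-stationary correlations) Fix 0 < α < 1. There exist a constant C_α depending only on α and an affine function F : ℝ → ℝ such that for every φ ∈ L^∞(m), every ψ ∈ C¹(S¹), every n > 1, and every sequence β₁, …, β_n ∈ (0, α], one has |∫ ψ · (φ ∘ T_{β_n} ∘ ⋯ ∘ T_{β_1}) dm − (∫ ψ dm)(∫ φ ∘ T_{β_n} ∘ ⋯ ∘ T_{β_1} dm)| ≤ C_α ‖φ‖_∞ F(‖ψ‖_{C¹}) n^{1 − 1/α} (log n)^{1/α}. -/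
open MeasureTheory Set

/-- The Pomeau–Manneville type map `T_β` on `[0,1]` (identified with the circle `S¹`):
`T_β x = x + 3^β/2^(1+β) x^(1+β)` for `x ≤ 2/3` and `T_β x = 3x - 2` otherwise. -/
noncomputable def Tmap (β x : ℝ) : ℝ :=
  if x ≤ 2/3 then x + (3:ℝ)^β / 2^(1+β) * x^(1+β) else 3*x - 2

/-- The derivative of `T_β` (left-branch formula at `x ≤ 2/3`). -/
noncomputable def Tderiv (β x : ℝ) : ℝ :=
  if x ≤ 2/3 then 1 + (3:ℝ)^β / 2^(1+β) * (1+β) * x^β else 3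

/-- The second derivative of `T_β`. -/
noncomputable def Tderiv2 (β x : ℝ) : ℝ :=
  if x ≤ 2/3 then (3:ℝ)^β / 2^(1+β) * (1+β) * β * x^(β-1) else 0

/-- The inverse of the left branch of `T_β` (for `x ∈ [0,1]` this is the unique
`y ∈ [0,2/3]` with `T_β y = x`). -/
noncomputable def leftInv (β x : ℝ) : ℝ :=
  sSup {y : ℝ | y ∈ Set.Icc (0:ℝ) (2/3) ∧ Tmap β y ≤ x}

/-- The Perron–Frobenius transfer operator of `T_β` with respect to Lebesgue measure:
`P_β f (x) = ∑_{y ∈ T_β⁻¹ x} f y / T_β' y`; the right branch preimage of `x` is `(x+2)/3`,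
where the derivative is `3`. -/
noncomputable def Pop (β : ℝ) (f : ℝ → ℝ) (x : ℝ) : ℝ :=
  f (leftInv β x) / Tderiv β (leftInv β x) + f ((x+2)/3) / 3

/-- `P_{β_{k+n}} ∘ ⋯ ∘ P_{β_{k+1}}`. -/
noncomputable def PopCompFrom (β : ℕ → ℝ) (k : ℕ) : ℕ → (ℝ → ℝ) → ℝ → ℝ
  | 0, f => f
  | n+1, f => Pop (β (k+n+1)) (PopCompFrom β k n f)

/-- `P_{β_n} ∘ ⋯ ∘ P_{β_1}`. -/
noncomputable def PopComp (β : ℕ → ℝ) (n : ℕ) : (ℝ → ℝ) → ℝ → ℝ :=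
  PopCompFrom β 0 n

/-- `T_{β_{k+n}} ∘ ⋯ ∘ T_{β_{k+1}}`. -/
noncomputable def TcompFrom (β : ℕ → ℝ) (k : ℕ) : ℕ → ℝ → ℝ
  | 0, x => x
  | n+1, x => Tmap (β (k+n+1)) (TcompFrom β k n x)

/-- The derivative `(T_{β_{k+n}} ∘ ⋯ ∘ T_{β_{k+1}})'(z)`, computed as the product of the
derivatives along the orbit of `z`. -/
noncomputable def DcompFrom (β : ℕ → ℝ) (k n : ℕ) (z : ℝ) : ℝ :=
  ∏ i ∈ Finset.range n, Tderiv (β (k+i+1)) (TcompFrom β k i z)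

/-- The averaging operator `A_ε f (x) = (1/(2ε)) ∫_{B_ε(x)} f dm` on the circle,
realized via the 1-periodic extension of `f`. -/
noncomputable def Aop (ε : ℝ) (f : ℝ → ℝ) (x : ℝ) : ℝ :=
  (1/(2*ε)) * ∫ t in (x-ε)..(x+ε), f (Int.fract t)

/-- The indicator function of the ball `B_ε(z)` of radius `ε` around `z` in the circle `ℝ/ℤ`. -/
noncomputable def ballInd (ε z : ℝ) : ℝ → ℝ :=
  Set.indicator {y : ℝ | ∃ k : ℤ, |y - z - (k:ℝ)| < ε} (fun _ => 1)

/-- The cone `C₁ = {f ∈ C⁰((0,1]) : f ≥ 0, f decreasing, x ↦ x^(α+1) f x increasing}`. -/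
def memC1 (α : ℝ) (f : ℝ → ℝ) : Prop :=
  ContinuousOn f (Set.Ioc 0 1) ∧ (∀ x ∈ Set.Ioc (0:ℝ) 1, 0 ≤ f x) ∧
  AntitoneOn f (Set.Ioc 0 1) ∧ MonotoneOn (fun x : ℝ => x^(α+1) * f x) (Set.Ioc 0 1)

/-- `m(f) = ∫₀¹ f dm` (Lebesgue). -/
noncomputable def mInt (f : ℝ → ℝ) : ℝ := ∫ x in Set.Ioc (0:ℝ) 1, f x

/-- The cone `C₂ = {f ∈ C₁ ∩ L¹(m) : f x ≤ a x^(-α) m(f)}`. -/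
def memC2 (α a : ℝ) (f : ℝ → ℝ) : Prop :=
  memC1 α f ∧ IntegrableOn f (Set.Ioc 0 1) volume ∧
  ∀ x ∈ Set.Ioc (0:ℝ) 1, f x ≤ a * x^(-α) * mInt f

/-- The `L¹(m)` norm on `[0,1]`. -/
noncomputable def L1norm (f : ℝ → ℝ) : ℝ := ∫ x in Set.Ioc (0:ℝ) 1, |f x|

/-- The `C¹` norm `‖f‖_∞ + ‖f'‖_∞` on the circle. -/
noncomputable def C1norm (f : ℝ → ℝ) : ℝ :=
  (⨆ x : Set.Icc (0:ℝ) 1, |f (x:ℝ)|) + ⨆ x : Set.Icc (0:ℝ) 1, |deriv f (x:ℝ)|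

/-- On the left branch `T_β u = u (1 + s)` and `T_β' u = 1 + (1 + β) s` for a single small `s`. -/
lemma exists_left_branch_factor {α β u : ℝ} (hβ : β ∈ Ioc 0 α) (hu : u ∈ Ioc (0:ℝ) (2/3)) :
    ∃ s : ℝ, 0 < s ∧ s ≤ 1/2 ∧ Tmap β u = u * (1 + s) ∧ Tderiv β u = 1 + (1 + β) * s ∧
      (Tmap β u) ^ α ≤ 2 * s := by
  obtain ⟨hu0, hu1⟩ := hu
  obtain ⟨hβ0, hβα⟩ := hβ
  have hc : (3:ℝ) ^ β / 2 ^ (1 + β) * u ^ β = (3 * u / 2) ^ β / 2 := by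
    rw [Real.div_rpow (by positivity) (by norm_num), Real.mul_rpow (by norm_num) hu0.le,
      Real.rpow_add (by norm_num), Real.rpow_one]
    field_simp
  have h1 : (3 * u / 2) ^ β ≤ 1 := Real.rpow_le_one (by positivity) (by linarith) hβ0.le
  have hT : Tmap β u = u * (1 + (3 * u / 2) ^ β / 2) := by
    rw [Tmap, if_pos hu1, ← hc, Real.rpow_add hu0, Real.rpow_one]
    ring
  refine ⟨(3 * u / 2) ^ β / 2, by positivity, by linarith, hT, ?_, ?_⟩
  · rw [Tderiv, if_pos hu1, ← hc]
    ring
  · have h2 : (3 * u / 2) ^ α ≤ (3 * u / 2) ^ β :=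
      Real.rpow_le_rpow_of_exponent_ge (by positivity) (by linarith) hβα
    have h3 : Tmap β u ≤ 3 * u / 2 := by
      rw [hT]
      nlinarith
    have h4 : 0 ≤ Tmap β u := by
      rw [hT]
      positivity
    have h5 := Real.rpow_le_rpow h4 h3 (hβ0.le.trans hβα)
    linarith

lemma strictMonoOn_Tmap {β : ℝ} (hβ : 0 < β) : StrictMonoOn (Tmap β) (Icc 0 (2/3)) := by
  intro x hx y hy hxy
  rw [Tmap, Tmap, if_pos hx.2, if_pos hy.2]
  have h := Real.rpow_le_rpow hx.1 hxy.le (by linarith : 0 ≤ 1 + β)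
  have h2 := mul_le_mul_of_nonneg_left h (by positivity : 0 ≤ (3:ℝ) ^ β / 2 ^ (1 + β))
  linarith

lemma injOn_Tmap {β u : ℝ} (hβ : 0 < β) (hu : u ≤ 2/3) : InjOn (Tmap β) (Ioc 0 u) :=
  (strictMonoOn_Tmap hβ).injOn.mono
    (Ioc_subset_Icc_self.trans (Icc_subset_Icc_right hu))

lemma continuousOn_Tmap {β : ℝ} (hβ : 0 < β) : ContinuousOn (Tmap β) (Icc 0 (2/3)) := by
  have h : ContinuousOn (fun x : ℝ => x + (3:ℝ) ^ β / 2 ^ (1 + β) * x ^ (1 + β))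
      (Icc 0 (2/3)) :=
    (continuous_id.add (continuous_const.mul
      (Real.continuous_rpow_const (by linarith)))).continuousOn
  exact h.congr fun x hx => by rw [Tmap, if_pos hx.2]

lemma Tmap_zero {β : ℝ} (hβ : 0 < β) : Tmap β 0 = 0 := by
  rw [Tmap, if_pos (by norm_num), Real.zero_rpow (by linarith)]
  simp

lemma Tmap_two_thirds {β : ℝ} : Tmap β (2/3) = 1 := by
  rw [Tmap, if_pos le_rfl, Real.rpow_add (by norm_num), Real.rpow_add (by norm_num),
    Real.div_rpow (x := 2) (y := 3) (z := β) (by norm_num) (by norm_num), Real.rpow_one,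
    Real.rpow_one]
  field_simp
  norm_num

lemma Tmap_image_Ioc {β u : ℝ} (hβ : 0 < β) (hu : u ∈ Icc (0:ℝ) (2/3)) :
    Tmap β '' Ioc 0 u = Ioc 0 (Tmap β u) := by
  have hsub : Icc 0 u ⊆ Icc (0:ℝ) (2/3) := Icc_subset_Icc_right hu.2
  apply Subset.antisymm
  · rintro _ ⟨v, hv, rfl⟩
    constructor
    · have := strictMonoOn_Tmap hβ ⟨le_rfl, by norm_num⟩ (hsub ⟨hv.1.le, hv.2⟩) hv.1
      rwa [Tmap_zero hβ] at this
    · exact (strictMonoOn_Tmap hβ).monotoneOn (hsub ⟨hv.1.le, hv.2⟩) hu hv.2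
  · have h := intermediate_value_Ioc hu.1 ((continuousOn_Tmap hβ).mono hsub)
    rwa [Tmap_zero hβ] at h

lemma leftInv_Tmap {β u : ℝ} (hβ : 0 < β) (hu : u ∈ Icc (0:ℝ) (2/3)) :
    leftInv β (Tmap β u) = u := by
  have : {y : ℝ | y ∈ Icc (0:ℝ) (2/3) ∧ Tmap β y ≤ Tmap β u} = Icc 0 u := by
    ext y
    constructor
    · rintro ⟨hy, h⟩
      exact ⟨hy.1, ((strictMonoOn_Tmap hβ).le_iff_le hy hu).1 h⟩
    · intro hy
      have hy' : y ∈ Icc (0:ℝ) (2/3) := ⟨hy.1, hy.2.trans hu.2⟩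
      exact ⟨hy', ((strictMonoOn_Tmap hβ).le_iff_le hy' hu).2 hy.2⟩
  rw [leftInv, this, csSup_Icc hu.1]

lemma exists_Tmap_eq {β x : ℝ} (hβ : 0 < β) (hx : x ∈ Ioc (0:ℝ) 1) :
    ∃ u ∈ Ioc (0:ℝ) (2/3), Tmap β u = x ∧ leftInv β x = u := by
  have h := Tmap_image_Ioc hβ (u := 2/3) ⟨by norm_num, le_rfl⟩
  rw [Tmap_two_thirds] at h
  rw [← h] at hx
  obtain ⟨u, hu, rfl⟩ := hx
  exact ⟨u, hu, rfl, leftInv_Tmap hβ ⟨hu.1.le, hu.2⟩⟩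

lemma leftInv_one {β : ℝ} (hβ : 0 < β) : leftInv β 1 = 2/3 := by
  rw [← Tmap_two_thirds (β := β), leftInv_Tmap hβ ⟨by norm_num, le_rfl⟩]

lemma Tmap_mem_Ioc {β x : ℝ} (hβ : 0 < β) (hx : x ∈ Ioc (0:ℝ) 1) : Tmap β x ∈ Ioc (0:ℝ) 1 := by
  by_cases h : x ≤ 2/3
  · have h2 := Tmap_image_Ioc hβ (u := 2/3) ⟨by norm_num, le_rfl⟩
    rw [Tmap_two_thirds] at h2
    rw [← h2]
    exact mem_image_of_mem _ ⟨hx.1, h⟩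
  · rw [Tmap, if_neg h]
    constructor <;> linarith [hx.2]

lemma hasDerivWithinAt_Tmap {β u x : ℝ} (hu : u ≤ 2/3) (hx : x ∈ Ioc 0 u) :
    HasDerivWithinAt (Tmap β) (Tderiv β x) (Ioc 0 u) x := by
  have h : HasDerivAt (fun x : ℝ => x + (3:ℝ) ^ β / 2 ^ (1 + β) * x ^ (1 + β))
      (1 + (3:ℝ) ^ β / 2 ^ (1 + β) * ((1 + β) * x ^ (1 + β - 1))) x :=
    (hasDerivAt_id x).add ((Real.hasDerivAt_rpow_const (Or.inl hx.1.ne')).const_mul _)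
  have hd : Tderiv β x = 1 + (3:ℝ) ^ β / 2 ^ (1 + β) * ((1 + β) * x ^ (1 + β - 1)) := by
    rw [Tderiv, if_pos (hx.2.trans hu), add_sub_cancel_left]
    ring
  rw [hd]
  refine h.hasDerivWithinAt.congr (fun y hy => ?_) ?_
  · rw [Tmap, if_pos (hy.2.trans hu)]
  · rw [Tmap, if_pos (hx.2.trans hu)]

lemma monotoneOn_Tderiv {β : ℝ} (hβ : 0 < β) : MonotoneOn (Tderiv β) (Ioc 0 (2/3)) := by
  intro x hx y hy hxy
  rw [Tderiv, Tderiv, if_pos hx.2, if_pos hy.2]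
  have h := Real.rpow_le_rpow hx.1.le hxy hβ.le
  have h2 := mul_le_mul_of_nonneg_left h
    (by positivity : 0 ≤ (3:ℝ) ^ β / 2 ^ (1 + β) * (1 + β))
  linarith

lemma Tderiv_mem_Icc {β u : ℝ} (hβ : β ∈ Ioc (0:ℝ) 1) (hu : u ∈ Ioc (0:ℝ) (2/3)) :
    Tderiv β u ∈ Icc (1:ℝ) 2 := by
  obtain ⟨s, hs0, hs1, -, hd, -⟩ := exists_left_branch_factor hβ hu
  rw [hd]
  constructor <;> nlinarith [hβ.1, hβ.2]

lemma measurable_Tmap (β : ℝ) : Measurable (Tmap β) :=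
  Measurable.ite measurableSet_Iic (by fun_prop) (by fun_prop)

/-- The contribution of the left branch to the transfer operator. -/
noncomputable def leftOp (β : ℝ) (f : ℝ → ℝ) (x : ℝ) : ℝ :=
  f (leftInv β x) / Tderiv β (leftInv β x)

/-- The contribution of the right branch to the transfer operator. -/
noncomputable def rightOp (f : ℝ → ℝ) (x : ℝ) : ℝ := f ((x+2)/3) / 3

lemma Pop_eq (β : ℝ) (f : ℝ → ℝ) (x : ℝ) : Pop β f x = leftOp β f x + rightOp f x := rfl

lemma leftOp_Tmap {β u : ℝ} (hβ : β ∈ Ioc (0:ℝ) 1) (hu : u ∈ Ioc (0:ℝ) (2/3)) (f : ℝ → ℝ) :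
    |Tderiv β u| * leftOp β f (Tmap β u) = f u := by
  have h := Tderiv_mem_Icc hβ hu
  have hp : 0 < Tderiv β u := by linarith [h.1]
  rw [leftOp, leftInv_Tmap hβ.1 ⟨hu.1.le, hu.2⟩, abs_of_pos hp]
  field_simp

lemma setIntegral_leftOp_mul {β u : ℝ} (hβ : β ∈ Ioc (0:ℝ) 1) (hu : u ∈ Icc (0:ℝ) (2/3))
    (f g : ℝ → ℝ) :
    ∫ x in Ioc 0 (Tmap β u), leftOp β f x * g x = ∫ x in Ioc 0 u, f x * g (Tmap β x) := by
  rw [← Tmap_image_Ioc hβ.1 hu, integral_image_eq_integral_abs_deriv_smul measurableSet_Ioc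
    (fun x hx => hasDerivWithinAt_Tmap hu.2 hx)
    (injOn_Tmap hβ.1 hu.2)]
  refine setIntegral_congr_fun measurableSet_Ioc fun x hx => ?_
  simp only [smul_eq_mul]
  rw [← mul_assoc, leftOp_Tmap hβ ⟨hx.1, hx.2.trans hu.2⟩]

lemma integrableOn_leftOp {β : ℝ} (hβ : β ∈ Ioc (0:ℝ) 1) {f : ℝ → ℝ}
    (hf : IntegrableOn f (Ioc 0 1)) : IntegrableOn (leftOp β f) (Ioc 0 1) := by
  have h23 : (2/3 : ℝ) ∈ Icc (0:ℝ) (2/3) := ⟨by norm_num, le_rfl⟩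
  rw [← Tmap_two_thirds (β := β), ← Tmap_image_Ioc hβ.1 h23,
    integrableOn_image_iff_integrableOn_abs_deriv_smul measurableSet_Ioc
    (fun x hx => hasDerivWithinAt_Tmap le_rfl hx)
    (injOn_Tmap hβ.1 le_rfl)]
  refine (hf.mono_set (Ioc_subset_Ioc_right (by norm_num : (2/3:ℝ) ≤ 1))).congr_fun
    (fun x hx => ?_) measurableSet_Ioc
  simp only [smul_eq_mul]
  rw [leftOp_Tmap hβ hx]

lemma image_right_branch : (fun x : ℝ => 3 * x - 2) '' Ioc (2/3) 1 = Ioc 0 1 := by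
  ext y
  constructor
  · rintro ⟨x, hx, rfl⟩
    constructor <;> simp only <;> linarith [hx.1, hx.2]
  · intro hy
    exact ⟨(y + 2) / 3, ⟨by linarith [hy.1], by linarith [hy.2]⟩, by ring⟩

lemma hasDerivWithinAt_right_branch (x : ℝ) (s : Set ℝ) :
    HasDerivWithinAt (fun x : ℝ => 3 * x - 2) 3 s x := by
  simpa using (((hasDerivAt_id x).const_mul 3).sub_const 2).hasDerivWithinAt

lemma injOn_right_branch (s : Set ℝ) : InjOn (fun x : ℝ => 3 * x - 2) s :=
  fun x _ y _ h => by simp only at h; linarith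

lemma setIntegral_rightOp_mul (f g : ℝ → ℝ) (β : ℝ) :
    ∫ x in Ioc 0 1, rightOp f x * g x = ∫ x in Ioc (2/3) 1, f x * g (Tmap β x) := by
  rw [← image_right_branch, integral_image_eq_integral_abs_deriv_smul measurableSet_Ioc
    (fun x _ => hasDerivWithinAt_right_branch x _) (injOn_right_branch _)]
  refine setIntegral_congr_fun measurableSet_Ioc fun x hx => ?_
  simp only [smul_eq_mul, rightOp]
  rw [Tmap, if_neg (not_le.2 hx.1), abs_of_pos (by norm_num : (0:ℝ) < 3),
    show (3 * x - 2 + 2) / 3 = x by ring]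
  ring

lemma integrableOn_rightOp {f : ℝ → ℝ} (hf : IntegrableOn f (Ioc 0 1)) :
    IntegrableOn (rightOp f) (Ioc 0 1) := by
  rw [← image_right_branch, integrableOn_image_iff_integrableOn_abs_deriv_smul measurableSet_Ioc
    (fun x _ => hasDerivWithinAt_right_branch x _) (injOn_right_branch _)]
  refine (hf.mono_set (Ioc_subset_Ioc_left (by norm_num : (0:ℝ) ≤ 2/3))).congr_fun
    (fun x hx => ?_) measurableSet_Ioc
  simp only [smul_eq_mul, rightOp]
  rw [abs_of_pos (by norm_num : (0:ℝ) < 3), show (3 * x - 2 + 2) / 3 = x by ring]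
  ring

/-- Nonnegative, decreasing, integrable functions on `(0,1]`. -/
structure DecreasingDensity (f : ℝ → ℝ) : Prop where
  anti : AntitoneOn f (Ioc 0 1)
  nonneg : ∀ x ∈ Ioc (0:ℝ) 1, 0 ≤ f x
  int : IntegrableOn f (Ioc 0 1)

lemma right_preimage_mem {x : ℝ} (hx : x ∈ Ioc (0:ℝ) 1) : (x + 2) / 3 ∈ Ioc (0:ℝ) 1 :=
  ⟨by linarith [hx.1], by linarith [hx.2]⟩

lemma mInt_eq_add {f : ℝ → ℝ} (hf : IntegrableOn f (Ioc 0 1)) {a : ℝ} (ha : a ∈ Icc (0:ℝ) 1) :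
    mInt f = (∫ x in Ioc 0 a, f x) + ∫ x in Ioc a 1, f x := by
  rw [mInt, ← Ioc_union_Ioc_eq_Ioc ha.1 ha.2, setIntegral_union (Ioc_disjoint_Ioc_of_le le_rfl)
    measurableSet_Ioc (hf.mono_set (Ioc_subset_Ioc_right ha.2))
    (hf.mono_set (Ioc_subset_Ioc_left ha.1))]

lemma mInt_const (c : ℝ) : mInt (fun _ => c) = c := by
  simp [mInt]

namespace DecreasingDensity

variable {f g : ℝ → ℝ}

lemma add (hf : DecreasingDensity f) (hg : DecreasingDensity g) :
    DecreasingDensity (fun x => f x + g x) :=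
  ⟨fun _ hx _ hy h => add_le_add (hf.anti hx hy h) (hg.anti hx hy h),
    fun x hx => add_nonneg (hf.nonneg x hx) (hg.nonneg x hx), hf.int.add hg.int⟩

lemma const {c : ℝ} (hc : 0 ≤ c) : DecreasingDensity (fun _ => c) :=
  ⟨fun _ _ _ _ _ => le_rfl, fun _ _ => hc, by simp⟩

lemma leftOp {β : ℝ} (hβ : β ∈ Ioc (0:ℝ) 1) (hf : DecreasingDensity f) :
    DecreasingDensity (leftOp β f) := by
  have h1 : Ioc (0:ℝ) (2/3) ⊆ Ioc 0 1 := Ioc_subset_Ioc_right (by norm_num)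
  refine ⟨fun x hx y hy h => ?_, fun x hx => ?_, integrableOn_leftOp hβ hf.int⟩
  · obtain ⟨u, hu, rfl, hu'⟩ := exists_Tmap_eq hβ.1 hx
    obtain ⟨v, hv, rfl, hv'⟩ := exists_Tmap_eq hβ.1 hy
    have huv : u ≤ v := ((strictMonoOn_Tmap hβ.1).le_iff_le ⟨hu.1.le, hu.2⟩ ⟨hv.1.le, hv.2⟩).1 h
    rw [_root_.leftOp, _root_.leftOp, hu', hv']
    exact div_le_div₀ (hf.nonneg _ (h1 hu)) (hf.anti (h1 hu) (h1 hv) huv)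
      (by linarith [(Tderiv_mem_Icc hβ hu).1]) (monotoneOn_Tderiv hβ.1 hu hv huv)
  · obtain ⟨u, hu, rfl, hu'⟩ := exists_Tmap_eq hβ.1 hx
    rw [_root_.leftOp, hu']
    exact div_nonneg (hf.nonneg _ (h1 hu)) (by linarith [(Tderiv_mem_Icc hβ hu).1])

lemma rightOp (hf : DecreasingDensity f) : DecreasingDensity (rightOp f) := by
  refine ⟨fun x hx y hy h => ?_, fun x hx => ?_, integrableOn_rightOp hf.int⟩
  · have := hf.anti (right_preimage_mem hx) (right_preimage_mem hy) (by linarith)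
    simp only [_root_.rightOp]
    linarith
  · have := hf.nonneg _ (right_preimage_mem hx)
    simp only [_root_.rightOp]
    linarith

lemma pop {β : ℝ} (hβ : β ∈ Ioc (0:ℝ) 1) (hf : DecreasingDensity f) :
    DecreasingDensity (Pop β f) :=
  (hf.leftOp hβ).add hf.rightOp

lemma setIntegral_Ioc_le (hf : DecreasingDensity f) {a : ℝ} (ha : a ∈ Ioc (0:ℝ) 1) :
    ∫ x in Ioc a 1, f x ≤ (1 - a) * f a := by
  have hsub : Ioc a 1 ⊆ Ioc 0 1 := Ioc_subset_Ioc_left ha.1.le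
  have h := setIntegral_mono_on (hf.int.mono_set hsub)
    (by simp : IntegrableOn (fun _ => f a) (Ioc a 1) volume)
    measurableSet_Ioc fun x hx => hf.anti ha (hsub hx) hx.1.le
  simpa [ha.2] using h

lemma mul_le_mInt (hf : DecreasingDensity f) {a : ℝ} (ha : a ∈ Ioc (0:ℝ) 1) :
    a * f a ≤ mInt f := by
  have hsub : Ioc 0 a ⊆ Ioc 0 1 := Ioc_subset_Ioc_right ha.2
  have h := setIntegral_mono_on (by simp : IntegrableOn (fun _ => f a) (Ioc 0 a) volume)
    (hf.int.mono_set hsub)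
    measurableSet_Ioc fun x hx => hf.anti (hsub hx) ha hx.2
  have h2 : 0 ≤ ∫ x in Ioc a 1, f x := setIntegral_nonneg measurableSet_Ioc
    fun x hx => hf.nonneg x ⟨ha.1.trans hx.1, hx.2⟩
  rw [mInt_eq_add hf.int (Ioc_subset_Icc_self ha)]
  simp only [integral_const, smul_eq_mul, measureReal_restrict_apply_univ, Real.volume_real_Ioc,
    sub_zero, max_eq_left ha.1.le] at h
  linarith

end DecreasingDensity

lemma mInt_leftOp {β : ℝ} (hβ : β ∈ Ioc (0:ℝ) 1) (f : ℝ → ℝ) :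
    mInt (leftOp β f) = ∫ x in Ioc 0 (2/3), f x := by
  simpa [mInt, Tmap_two_thirds] using
    setIntegral_leftOp_mul hβ (u := 2/3) ⟨by norm_num, le_rfl⟩ f (fun _ => 1)

lemma integrableOn_mul_of_bounded {f Φ : ℝ → ℝ} {B : ℝ} (hf : IntegrableOn f (Ioc 0 1))
    (hΦ : Measurable Φ) (hB : ∀ x ∈ Ioc (0:ℝ) 1, |Φ x| ≤ B) :
    IntegrableOn (fun x => f x * Φ x) (Ioc 0 1) :=
  hf.mul_bdd hΦ.aestronglyMeasurable ((ae_restrict_iff' measurableSet_Ioc).2 (ae_of_all _ hB))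

lemma setIntegral_Pop_mul {β : ℝ} (hβ : β ∈ Ioc (0:ℝ) 1) {f g : ℝ → ℝ}
    (hf : IntegrableOn f (Ioc 0 1)) (hg : Measurable g) {B : ℝ}
    (hB : ∀ x ∈ Ioc (0:ℝ) 1, |g x| ≤ B) :
    ∫ x in Ioc 0 1, Pop β f x * g x = ∫ x in Ioc 0 1, f x * g (Tmap β x) := by
  have h1 := integrableOn_mul_of_bounded (integrableOn_leftOp hβ hf) hg hB
  have h2 := integrableOn_mul_of_bounded (integrableOn_rightOp hf) hg hB
  have h3 := integrableOn_mul_of_bounded hf (hg.comp (measurable_Tmap β))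
    fun x hx => hB _ (Tmap_mem_Ioc hβ.1 hx)
  simp only [Pop_eq, add_mul]
  rw [integral_add h1 h2, setIntegral_rightOp_mul f g β]
  have h4 := setIntegral_leftOp_mul hβ (u := 2/3) ⟨by norm_num, le_rfl⟩ f g
  rw [Tmap_two_thirds] at h4
  rw [h4]
  exact (mInt_eq_add h3 ⟨by norm_num, by norm_num⟩).symm

lemma mInt_Pop {β : ℝ} (hβ : β ∈ Ioc (0:ℝ) 1) {f : ℝ → ℝ}
    (hf : IntegrableOn f (Ioc 0 1)) : mInt (Pop β f) = mInt f := by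
  simpa [mInt] using setIntegral_Pop_mul hβ hf (g := fun _ => 1) measurable_const (B := 1) (by simp)

lemma Pop_mono {β : ℝ} (hβ : β ∈ Ioc (0:ℝ) 1) {f g : ℝ → ℝ}
    (h : ∀ x ∈ Ioc (0:ℝ) 1, f x ≤ g x) : ∀ x ∈ Ioc (0:ℝ) 1, Pop β f x ≤ Pop β g x := by
  intro x hx
  obtain ⟨u, hu, -, hu'⟩ := exists_Tmap_eq hβ.1 hx
  have h1 := h u ⟨hu.1, hu.2.trans (by norm_num)⟩
  have h2 := h _ (right_preimage_mem hx)
  have h3 := (Tderiv_mem_Icc hβ hu).1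
  rw [Pop, Pop, hu']
  gcongr

lemma Pop_add (β : ℝ) (f g : ℝ → ℝ) (x : ℝ) :
    Pop β (fun y => f y + g y) x = Pop β f x + Pop β g x := by
  simp only [Pop]
  ring

/-- Decreasing densities of mass at most `M`, with a singularity at `0` controlled by
`M x^(-α)`. -/
structure TameDensity (α M : ℝ) (f : ℝ → ℝ) : Prop extends DecreasingDensity f where
  mass : mInt f ≤ M
  bound : ∀ x ∈ Ioc (0:ℝ) 1, f x ≤ 2 / (1 - α) * M * x ^ (-α)

lemma one_le_rpow_neg {α x : ℝ} (hα : 0 < α) (hx : x ∈ Ioc (0:ℝ) 1) : 1 ≤ x ^ (-α) :=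
  Real.one_le_rpow_of_pos_of_le_one_of_nonpos hx.1 hx.2 (by linarith)

lemma TameDensity.of_le {α M : ℝ} {f : ℝ → ℝ} (hα0 : 0 < α) (hα1 : α < 1)
    (hf : DecreasingDensity f) (hM : ∀ x ∈ Ioc (0:ℝ) 1, f x ≤ M) : TameDensity α M f := by
  have hM0 : 0 ≤ M := (hf.nonneg 1 (by simp)).trans (hM 1 (by simp))
  refine ⟨hf, ?_, fun x hx => (hM x hx).trans ?_⟩
  · rw [← mInt_const M]
    exact setIntegral_mono_on hf.int (by simp) measurableSet_Ioc hM
  · have h1 := one_le_rpow_neg hα0 hx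
    have h2 : 1 ≤ 2 / (1 - α) := by
      rw [le_div_iff₀] <;> linarith
    calc M = 1 * M * 1 := by ring
      _ ≤ 2 / (1 - α) * M * x ^ (-α) := by gcongr

lemma TameDensity.add {α M N : ℝ} {f g : ℝ → ℝ} (hf : TameDensity α M f)
    (hg : TameDensity α N g) : TameDensity α (M + N) (fun x => f x + g x) := by
  refine ⟨hf.toDecreasingDensity.add hg.toDecreasingDensity, ?_, fun x hx => ?_⟩
  · rw [mInt, integral_add hf.int hg.int]
    exact add_le_add hf.mass hg.mass
  · have h1 := hf.bound x hx
    have h2 := hg.bound x hx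
    calc _ ≤ _ := add_le_add h1 h2
      _ = _ := by ring

lemma TameDensity.sub_const {α M c : ℝ} {f : ℝ → ℝ} (hf : TameDensity α M f) (hc : 0 ≤ c)
    (hfc : ∀ x ∈ Ioc (0:ℝ) 1, c ≤ f x) :
    TameDensity α M (fun x => f x - c) ∧ mInt (fun x => f x - c) = mInt f - c := by
  have hm : mInt (fun x => f x - c) = mInt f - c := by
    rw [mInt, integral_sub hf.int (by simp)]
    simp [mInt]
  refine ⟨⟨⟨fun x hx y hy h => sub_le_sub_right (hf.anti hx hy h) c,
    fun x hx => sub_nonneg.2 (hfc x hx), hf.int.sub (by simp)⟩, ?_, fun x hx => ?_⟩, hm⟩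
  · rw [hm]
    linarith [hf.mass]
  · linarith [hf.bound x hx]

lemma TameDensity.nonneg_bound {α M : ℝ} {f : ℝ → ℝ} (hf : TameDensity α M f) : 0 ≤ M :=
  (setIntegral_nonneg measurableSet_Ioc hf.nonneg).trans hf.mass

lemma rpow_neg_mul_one_add {α u s : ℝ} (hu : 0 < u) (hs : 0 < s) :
    (u * (1 + s)) ^ (-α) * (1 + s) ^ α = u ^ (-α) := by
  have h : (0:ℝ) < 1 + s := by linarith
  rw [Real.mul_rpow hu.le h.le, mul_assoc, ← Real.rpow_add h, neg_add_cancel, Real.rpow_zero,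
    mul_one]

lemma one_le_rpow_neg_mul {α x s : ℝ} (hx : 0 < x) (h : x ^ α ≤ 2 * s) :
    1 ≤ x ^ (-α) * (2 * s) := by
  have h2 : 0 < x ^ (-α) := Real.rpow_pos_of_pos hx _
  have h3 : x ^ (-α) * x ^ α = 1 := by
    rw [← Real.rpow_add hx, neg_add_cancel, Real.rpow_zero]
  rw [← h3]
  gcongr

lemma TameDensity.pop {α β M : ℝ} {f : ℝ → ℝ} (hα1 : α < 1) (hβ : β ∈ Ioc 0 α)
    (hf : TameDensity α M f) : TameDensity α M (Pop β f) := by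
  have hβ1 : β ∈ Ioc (0:ℝ) 1 := ⟨hβ.1, hβ.2.trans hα1.le⟩
  refine ⟨hf.toDecreasingDensity.pop hβ1, (mInt_Pop hβ1 hf.int).trans_le hf.mass, fun x hx => ?_⟩
  have hM := hf.nonneg_bound
  obtain ⟨u, hu, rfl, hu'⟩ := exists_Tmap_eq hβ.1 hx
  obtain ⟨s, hs0, hs1, hTu, hdu, hsx⟩ := exists_left_branch_factor hβ hu
  have hz : (Tmap β u + 2) / 3 ∈ Ioc (0:ℝ) 1 := right_preimage_mem hx
  have h1 := hf.toDecreasingDensity.mul_le_mInt hz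
  have h2 := hf.nonneg _ hz
  have h3 := hf.mass
  have hR : f ((Tmap β u + 2) / 3) / 3 ≤ M / 2 := by nlinarith [hx.1]
  have hL := hf.bound u ⟨hu.1, hu.2.trans (by norm_num)⟩
  have hX : 0 < (Tmap β u) ^ (-α) := Real.rpow_pos_of_pos hx.1 _
  have hXs := one_le_rpow_neg_mul hx.1 hsx
  have hB : (1 + s) ^ α ≤ 1 + α * s :=
    rpow_one_add_le_one_add_mul_self (by linarith) (hβ.1.le.trans hβ.2) hα1.le
  rw [Pop, hu', hdu]
  have hA : u ^ (-α) ≤ (Tmap β u) ^ (-α) * (1 + α * s) := by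
    rw [← rpow_neg_mul_one_add hu.1 hs0, ← hTu]
    gcongr
  set X := (Tmap β u) ^ (-α)
  have hα1' : 0 < 1 - α := by linarith
  have hD : 0 < 1 + (1 + β) * s := by nlinarith [hβ.1]
  have hLX : f u / (1 + (1 + β) * s) ≤ 2 / (1 - α) * M * X - M / 2 := by
    rw [div_le_iff₀ hD]
    have h5 : f u ≤ 2 / (1 - α) * M * (X * (1 + α * s)) :=
      hL.trans (by gcongr)
    have h6 : M * (1 - α) * (1 + (1 + β) * s) ≤ M * (1 - α) * (X * (2 * s) * 2) := by
      gcongr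
      nlinarith [mul_nonneg (sub_nonneg.2 hβ1.2) hs0.le]
    have h7 : 0 ≤ M * X * s * β := by
      have := hβ.1
      positivity
    have h8 : 2 * M * (X * (1 + α * s)) ≤
        (2 * M * X - M / 2 * (1 - α)) * (1 + (1 + β) * s) := by
      nlinarith
    have h9 := div_le_div_of_nonneg_right h8 hα1'.le
    calc f u ≤ _ := h5
      _ = 2 * M * (X * (1 + α * s)) / (1 - α) := by ring
      _ ≤ _ := h9
      _ = _ := by field_simp
  linarith

lemma PopCompFrom_add (β : ℕ → ℝ) (k n m : ℕ) (f : ℝ → ℝ) :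
    PopCompFrom β k (n + m) f = PopCompFrom β (k + n) m (PopCompFrom β k n f) := by
  induction m with
  | zero => rfl
  | succ m ih =>
    rw [← add_assoc, PopCompFrom, PopCompFrom, ih, add_assoc k n m]

section Sequence

variable {α : ℝ} {β : ℕ → ℝ}

lemma mem_Ioc_one (hα1 : α < 1) (hβ : ∀ i, β i ∈ Ioc 0 α) (i : ℕ) : β i ∈ Ioc (0:ℝ) 1 :=
  ⟨(hβ i).1, (hβ i).2.trans hα1.le⟩

lemma PopCompFrom_mono (hβ : ∀ i, β i ∈ Ioc (0:ℝ) 1) (k n : ℕ) {f g : ℝ → ℝ}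
    (h : ∀ x ∈ Ioc (0:ℝ) 1, f x ≤ g x) :
    ∀ x ∈ Ioc (0:ℝ) 1, PopCompFrom β k n f x ≤ PopCompFrom β k n g x := by
  induction n with
  | zero => exact h
  | succ n ih => exact Pop_mono (hβ _) ih

lemma TameDensity.popCompFrom (hα1 : α < 1) (hβ : ∀ i, β i ∈ Ioc 0 α) (k n : ℕ) {M : ℝ}
    {f : ℝ → ℝ} (hf : TameDensity α M f) :
    TameDensity α M (PopCompFrom β k n f) ∧ mInt (PopCompFrom β k n f) = mInt f := by
  induction n with
  | zero => exact ⟨hf, rfl⟩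
  | succ n ih =>
    exact ⟨ih.1.pop hα1 (hβ _), (mInt_Pop (mem_Ioc_one hα1 hβ _) ih.1.int).trans ih.2⟩

end Sequence

/-- Composition of the left-branch operators along the sequence `β`. -/
noncomputable def leftOpComp (β : ℕ → ℝ) (k : ℕ) : ℕ → (ℝ → ℝ) → ℝ → ℝ
  | 0, f => f
  | n+1, f => leftOp (β (k+n+1)) (leftOpComp β k n f)

lemma DecreasingDensity.leftOpComp {β : ℕ → ℝ} (hβ : ∀ i, β i ∈ Ioc (0:ℝ) 1) (k n : ℕ)
    {f : ℝ → ℝ} (hf : DecreasingDensity f) : DecreasingDensity (leftOpComp β k n f) := by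
  induction n with
  | zero => exact hf
  | succ n ih => exact ih.leftOp (hβ _)

lemma leftOp_le_Pop (β : ℝ) {f : ℝ → ℝ} (hf : DecreasingDensity f) :
    ∀ x ∈ Ioc (0:ℝ) 1, leftOp β f x ≤ Pop β f x := by
  intro x hx
  have := hf.rightOp.nonneg x hx
  rw [Pop_eq]
  linarith

lemma leftOpComp_le_PopCompFrom {β : ℕ → ℝ} (hβ : ∀ i, β i ∈ Ioc (0:ℝ) 1) (k n : ℕ)
    {f : ℝ → ℝ} (hf : DecreasingDensity f) :
    ∀ x ∈ Ioc (0:ℝ) 1, leftOpComp β k n f x ≤ PopCompFrom β k n f x := by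
  induction n with
  | zero => exact fun x _ => le_rfl
  | succ n ih =>
    exact fun x hx => (leftOp_le_Pop _ (hf.leftOpComp hβ k n) x hx).trans (Pop_mono (hβ _) ih x hx)

lemma rpow_neg_add_le_leftInv {α β u : ℝ} (hα : 0 < α) (hβ : β ∈ Ioc 0 α)
    (hu : u ∈ Ioc (0:ℝ) (2/3)) : (Tmap β u) ^ (-α) + α / 3 ≤ u ^ (-α) := by
  obtain ⟨s, hs0, hs1, hTu, hdu, hsx⟩ := exists_left_branch_factor hβ hu
  have hT : 0 < Tmap β u := by
    rw [hTu]
    nlinarith [hu.1]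
  have hX : 0 < (Tmap β u) ^ (-α) := Real.rpow_pos_of_pos hT _
  have hXs := one_le_rpow_neg_mul hT hsx
  have hp : (0:ℝ) < 1 + s := by linarith
  have h1 : 1 + α * (2 * s / 3) ≤ (1 + s) ^ α := by
    have h2 : 2 * s / 3 ≤ Real.log (1 + s) := by
      refine le_trans ?_ (Real.one_sub_inv_le_log_of_pos hp)
      rw [le_sub_iff_add_le, ← le_sub_iff_add_le', inv_le_iff_one_le_mul₀ hp]
      nlinarith
    rw [Real.rpow_def_of_pos hp]
    have h3 := Real.add_one_le_exp (Real.log (1 + s) * α)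
    nlinarith
  rw [← rpow_neg_mul_one_add hu.1 hs0, ← hTu]
  have h4 := mul_le_mul_of_nonneg_left h1 hX.le
  nlinarith

/-- Iterating left branches backwards from `x` leads to a point `y` close to `0`. -/
lemma exists_left_preimage {α : ℝ} {β : ℕ → ℝ} (hα0 : 0 < α) (hα1 : α < 1)
    (hβ : ∀ i, β i ∈ Ioc 0 α) (k n : ℕ) {f : ℝ → ℝ} (hf : DecreasingDensity f) :
    ∀ x ∈ Ioc (0:ℝ) 1, ∃ y ∈ Ioc (0:ℝ) 1, x ^ (-α) + n * (α / 3) ≤ y ^ (-α) ∧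
      ∫ t in Ioc 0 x, leftOpComp β k n f t = ∫ t in Ioc 0 y, f t ∧
      f y ≤ 2 ^ n * leftOpComp β k n f x := by
  have hβ1 := mem_Ioc_one hα1 hβ
  induction n with
  | zero => exact fun x hx => ⟨x, hx, by simp, rfl, by simp [leftOpComp]⟩
  | succ n ih =>
    intro x hx
    obtain ⟨u, hu, rfl, hu'⟩ := exists_Tmap_eq (hβ (k + n + 1)).1 hx
    obtain ⟨y, hy, h1, h2, h3⟩ := ih u ⟨hu.1, hu.2.trans (by norm_num)⟩
    refine ⟨y, hy, ?_, ?_, h3.trans ?_⟩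
    · have := rpow_neg_add_le_leftInv hα0 (hβ (k + n + 1)) hu
      push_cast
      linarith
    · rw [← h2]
      simpa [leftOpComp] using setIntegral_leftOp_mul (hβ1 (k + n + 1)) (Ioc_subset_Icc_self hu)
        (leftOpComp β k n f) (fun _ => 1)
    · have hd := Tderiv_mem_Icc (hβ1 (k + n + 1)) hu
      have h0 := (hf.leftOpComp hβ1 k n).nonneg u ⟨hu.1, hu.2.trans (by norm_num)⟩
      rw [leftOpComp, leftOp, hu', pow_succ, mul_assoc]
      gcongr
      rw [← mul_div_assoc, le_div_iff₀ (by linarith [hd.1])]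
      nlinarith [hd.2]

lemma TameDensity.setIntegral_Ioc_zero_le {α M y : ℝ} {f : ℝ → ℝ} (hα1 : α < 1)
    (hf : TameDensity α M f) (hy : y ∈ Ioc (0:ℝ) 1) :
    ∫ t in Ioc 0 y, f t ≤ M * (2 / (1 - α) ^ 2) * y ^ (1 - α) := by
  have hsub : Ioc 0 y ⊆ Ioc 0 1 := Ioc_subset_Ioc_right hy.2
  have hi : IntervalIntegrable (fun x : ℝ => 2 / (1 - α) * M * x ^ (-α)) volume 0 y :=
    (intervalIntegral.intervalIntegrable_rpow' (by linarith)).const_mul _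
  have h := setIntegral_mono_on (hf.int.mono_set hsub)
    ((intervalIntegrable_iff_integrableOn_Ioc_of_le hy.1.le).1 hi) measurableSet_Ioc
    fun x hx => hf.bound x (hsub hx)
  refine h.trans_eq ?_
  rw [← intervalIntegral.integral_of_le hy.1.le, intervalIntegral.integral_const_mul,
    integral_rpow (Or.inl (by linarith)), show -α + 1 = 1 - α by ring,
    Real.zero_rpow (by linarith)]
  have : 1 - α ≠ 0 := by linarith
  field_simp
  ring

/-- The constant in the polynomial bound for the mass that stays in the left branch. -/
noncomputable def tailConst (α : ℝ) : ℝ := 2 / (1 - α) ^ 2 * (α / 3) ^ (1 - 1 / α)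

lemma tailConst_pos {α : ℝ} (hα0 : 0 < α) (hα1 : α < 1) : 0 < tailConst α := by
  have : 0 < 1 - α := by linarith
  unfold tailConst
  positivity

lemma one_sub_one_div_neg {α : ℝ} (hα0 : 0 < α) (hα1 : α < 1) : 1 - 1 / α < 0 := by
  rw [sub_neg, lt_div_iff₀ hα0]
  linarith

lemma TameDensity.setIntegral_le_tail {α M x y : ℝ} {n : ℕ} {f : ℝ → ℝ} (hα0 : 0 < α)
    (hα1 : α < 1) (hf : TameDensity α M f) (hx : x ∈ Ioc (0:ℝ) 1) (hy : y ∈ Ioc (0:ℝ) 1)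
    (hxy : x ^ (-α) + n * (α / 3) ≤ y ^ (-α)) :
    ∫ t in Ioc 0 y, f t ≤ M * (tailConst α * ((n:ℝ) + 1) ^ (1 - 1 / α)) := by
  have hM := hf.nonneg_bound
  have h1 := one_le_rpow_neg hα0 hx
  have h2 : α / 3 * ((n:ℝ) + 1) ≤ y ^ (-α) := by linarith
  have h3 : y ^ (1 - α) ≤ (α / 3) ^ (1 - 1 / α) * ((n:ℝ) + 1) ^ (1 - 1 / α) := by
    rw [← Real.mul_rpow (by positivity) (by positivity)]
    have h4 : y ^ (1 - α) = (y ^ (-α)) ^ (1 - 1 / α) := by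
      rw [← Real.rpow_mul hy.1.le]
      congr 1
      field_simp
      ring
    rw [h4]
    exact Real.rpow_le_rpow_of_nonpos (by positivity) h2 (one_sub_one_div_neg hα0 hα1).le
  refine (hf.setIntegral_Ioc_zero_le hα1 hy).trans ?_
  rw [tailConst, mul_assoc, mul_assoc (2 / (1 - α) ^ 2)]
  gcongr

section Sequence

variable {α M : ℝ} {β : ℕ → ℝ} {f : ℝ → ℝ}

lemma TameDensity.mInt_leftOpComp_le (hα0 : 0 < α) (hα1 : α < 1) (hβ : ∀ i, β i ∈ Ioc 0 α)
    (hf : TameDensity α M f) (k n : ℕ) :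
    mInt (_root_.leftOpComp β k n f) ≤ M * (tailConst α * ((n:ℝ) + 1) ^ (1 - 1 / α)) := by
  obtain ⟨y, hy, h1, h2, -⟩ :=
    exists_left_preimage hα0 hα1 hβ k n hf.toDecreasingDensity 1 (by simp)
  rw [mInt, h2]
  exact hf.setIntegral_le_tail hα0 hα1 (by simp) hy h1

lemma TameDensity.le_two_pow_mul_popCompFrom (hα0 : 0 < α) (hα1 : α < 1)
    (hβ : ∀ i, β i ∈ Ioc 0 α) (hf : TameDensity α M f) (k n : ℕ) :
    ∀ x ∈ Ioc (0:ℝ) 1, mInt f - M * (tailConst α * ((n:ℝ) + 1) ^ (1 - 1 / α)) ≤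
      2 ^ n * PopCompFrom β k n f x := by
  intro x hx
  have hβ1 := mem_Ioc_one hα1 hβ
  have h1 : (1:ℝ) ∈ Ioc (0:ℝ) 1 := by simp
  obtain ⟨y, hy, hy1, -, hy3⟩ :=
    exists_left_preimage hα0 hα1 hβ k n hf.toDecreasingDensity 1 h1
  have h2 := hf.setIntegral_le_tail hα0 hα1 h1 hy hy1
  have h3 := hf.toDecreasingDensity.setIntegral_Ioc_le hy
  have h4 := mInt_eq_add hf.int (Ioc_subset_Icc_self hy)
  have h5 := hf.nonneg y hy
  have h6 := leftOpComp_le_PopCompFrom hβ1 k n hf.toDecreasingDensity 1 h1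
  have h7 := (hf.popCompFrom hα1 hβ k n).1.anti hx h1 hx.2
  have h8 : (2:ℝ) ^ n * leftOpComp β k n f 1 ≤ 2 ^ n * PopCompFrom β k n f x := by
    gcongr
    exact h6.trans h7
  nlinarith [hy.1]

/-- The mass that has left the left branch dominates a tame density of comparable mass. -/
lemma exists_tame_le_PopCompFrom (hα0 : 0 < α) (hα1 : α < 1)
    (hβ : ∀ i, β i ∈ Ioc 0 α) (hf : DecreasingDensity f) (k n : ℕ) :
    ∃ G : ℝ → ℝ, TameDensity α (mInt G) G ∧
      (∀ x ∈ Ioc (0:ℝ) 1, leftOpComp β k (n + 1) f x + G x ≤ PopCompFrom β k (n + 1) f x) ∧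
      mInt f - mInt (leftOpComp β k n f) ≤ 2 * mInt G := by
  have hβ1 := mem_Ioc_one hα1 hβ
  have h1 : (1:ℝ) ∈ Ioc (0:ℝ) 1 := by simp
  induction n with
  | zero =>
    refine ⟨fun _ => 0, ?_, fun x hx => ?_, ?_⟩
    · rw [mInt_const]
      exact .of_le hα0 hα1 (.const le_rfl) (by simp)
    · rw [add_zero]
      exact leftOp_le_Pop _ hf x hx
    · simp only [leftOpComp, mInt_const]
      linarith
  | succ n ih =>
    obtain ⟨G, hG, hG1, hG2⟩ := ih
    have hL := hf.leftOpComp hβ1 k n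
    have hL' := hf.leftOpComp hβ1 k (n + 1)
    set ν : ℝ := leftOpComp β k (n + 1) f 1 / 3 with hν
    have hν0 : 0 ≤ ν := by
      have := hL'.nonneg 1 h1
      positivity
    have hGP := hG.pop hα1 (hβ (k + (n + 1) + 1))
    have hm : mInt (fun x => Pop (β (k + (n + 1) + 1)) G x + ν) = mInt G + ν := by
      rw [mInt, integral_add hGP.int (by simp)]
      change mInt _ + mInt _ = _
      rw [mInt_Pop (hβ1 _) hG.int, mInt_const]
    have hνT : TameDensity α ν (fun _ => ν) := .of_le hα0 hα1 (.const hν0) (by simp)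
    refine ⟨fun x => Pop (β (k + (n + 1) + 1)) G x + ν, ?_, fun x hx => ?_, ?_⟩
    · rw [hm]
      exact hGP.add hνT
    · have h2 := Pop_mono (hβ1 (k + (n + 1) + 1)) hG1 x hx
      rw [Pop_add, Pop_eq _ (leftOpComp β k (n + 1) f)] at h2
      have h3 : ν ≤ rightOp (leftOpComp β k (n + 1) f) x := by
        have := hL'.anti (right_preimage_mem hx) h1 (right_preimage_mem hx).2
        simp only [rightOp, hν]
        linarith
      rw [leftOpComp, PopCompFrom]
      linarith
    · have h23 : (2/3 : ℝ) ∈ Ioc (0:ℝ) 1 := ⟨by norm_num, by norm_num⟩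
      have h2 := mInt_leftOp (hβ1 (k + n + 1)) (leftOpComp β k n f)
      have h3 := mInt_eq_add hL.int (Ioc_subset_Icc_self h23)
      have h4 := hL.setIntegral_Ioc_le h23
      have h5 := Tderiv_mem_Icc (hβ1 (k + n + 1)) (u := 2/3) ⟨by norm_num, le_rfl⟩
      have h6 : leftOpComp β k n f (2/3) ≤ 2 * (3 * ν) := by
        have h7 : 3 * ν = leftOpComp β k n f (2/3) / Tderiv (β (k + n + 1)) (2/3) := by
          rw [hν, leftOpComp, leftOp, leftInv_one (hβ1 _).1]
          ring
        rw [h7, ← mul_div_assoc, le_div_iff₀ (by linarith [h5.1])]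
        have := hL.nonneg _ h23
        nlinarith [h5.2]
      rw [hm]
      change mInt f - mInt (leftOp (β (k + n + 1)) (leftOpComp β k n f)) ≤ _
      linarith

end Sequence

/-- Uniform lower bound for the iterated transfer operators. -/
lemma exists_uniform_lower_bound {α : ℝ} (hα0 : 0 < α) (hα1 : α < 1) :
    ∃ γ > 0, γ < 1 ∧ ∃ C > 0, ∀ (β : ℕ → ℝ), (∀ i, β i ∈ Ioc 0 α) → ∀ (k N : ℕ) (M : ℝ)
      (f : ℝ → ℝ), TameDensity α M f → ∀ x ∈ Ioc (0:ℝ) 1,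
        γ * (mInt f - M * (C * ((N:ℝ) + 1) ^ (1 - 1 / α))) ≤ PopCompFrom β k N f x := by
  have he := one_sub_one_div_neg hα0 hα1
  have hc := tailConst_pos hα0 hα1
  obtain ⟨K, hK⟩ : ∃ K : ℕ, tailConst α * ((K:ℝ) + 1) ^ (1 - 1 / α) ≤ 1 / 2 := by
    have h1 : Filter.Tendsto (fun K : ℕ => tailConst α * ((K:ℝ) + 1) ^ (1 - 1 / α))
        Filter.atTop (nhds (tailConst α * 0)) := by
      refine Filter.Tendsto.const_mul _ ?_
      have h2 := (tendsto_rpow_neg_atTop (neg_pos.2 he)).comp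
        (Filter.tendsto_atTop_add_const_right _ (1:ℝ) tendsto_natCast_atTop_atTop)
      simpa [Function.comp_def] using h2
    rw [mul_zero] at h1
    exact (h1.eventually (ge_mem_nhds (by norm_num))).exists
  have hK2 : (0:ℝ) < ((K:ℝ) + 2) ^ (-(1 - 1 / α)) := by positivity
  refine ⟨1 / (2 ^ K * 4), by positivity, ?_, (tailConst α + 1) * ((K:ℝ) + 2) ^ (-(1 - 1 / α)),
    by positivity, fun β hβ k N M f hf x hx => ?_⟩
  · rw [div_lt_one (by positivity)]
    have : (1:ℝ) ≤ 2 ^ K := one_le_pow₀ (by norm_num)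
    linarith
  have hM := hf.nonneg_bound
  have hβ1 := mem_Ioc_one hα1 hβ
  have hscale : ∀ a : ℝ, 0 < a → (N:ℝ) + 1 ≤ (K + 2) * a →
      a ^ (1 - 1 / α) ≤ ((K:ℝ) + 2) ^ (-(1 - 1 / α)) * ((N:ℝ) + 1) ^ (1 - 1 / α) := by
    intro a ha h
    have h1 := Real.rpow_le_rpow_of_nonpos (by positivity) h he.le
    rw [Real.mul_rpow (by positivity) ha.le] at h1
    calc a ^ (1 - 1 / α) = ((K:ℝ) + 2) ^ (-(1 - 1 / α)) *
          (((K:ℝ) + 2) ^ (1 - 1 / α) * a ^ (1 - 1 / α)) := by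
          rw [← mul_assoc, ← Real.rpow_add (by positivity), neg_add_cancel, Real.rpow_zero,
            one_mul]
      _ ≤ _ := by gcongr
  have hN0 : (0:ℝ) < ((N:ℝ) + 1) ^ (1 - 1 / α) := by positivity
  rcases le_or_gt N K with hNK | hNK
  · have h1 := hscale 1 one_pos (by
      have : (N:ℝ) ≤ K := by exact_mod_cast hNK
      linarith)
    rw [Real.one_rpow] at h1
    have h2 : M * 1 ≤ M * ((tailConst α + 1) * ((K:ℝ) + 2) ^ (-(1 - 1 / α)) *
        ((N:ℝ) + 1) ^ (1 - 1 / α)) := by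
      gcongr
      nlinarith
    have h3 := hf.mass
    refine le_trans ?_ ((hf.popCompFrom hα1 hβ k N).1.nonneg x hx)
    exact mul_nonpos_of_nonneg_of_nonpos (by positivity) (by linarith)
  · obtain ⟨n, rfl⟩ : ∃ n, N = n + 1 + K := ⟨N - (K + 1), by omega⟩
    have h1 := hscale ((n:ℝ) + 1) (by positivity) (by
      push_cast
      have : (0:ℝ) ≤ (n:ℝ) * K := by positivity
      nlinarith)
    obtain ⟨G, hG, hG1, hG2⟩ := exists_tame_le_PopCompFrom hα0 hα1 hβ hf.toDecreasingDensity k n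
    have h2 := hf.mInt_leftOpComp_le hα0 hα1 hβ k n
    have h3 := hG.le_two_pow_mul_popCompFrom hα0 hα1 hβ (k + (n + 1)) K x hx
    have h4 : PopCompFrom β (k + (n + 1)) K G x ≤ PopCompFrom β k (n + 1 + K) f x := by
      rw [PopCompFrom_add]
      refine PopCompFrom_mono hβ1 _ _ (fun y hy => ?_) x hx
      have := (hf.toDecreasingDensity.leftOpComp hβ1 k (n + 1)).nonneg y hy
      linarith [hG1 y hy]
    have h5 : mInt G * (tailConst α * ((K:ℝ) + 1) ^ (1 - 1 / α)) ≤ mInt G * (1 / 2) :=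
      mul_le_mul_of_nonneg_left hK hG.nonneg_bound
    have h6 : M * (tailConst α * ((n:ℝ) + 1) ^ (1 - 1 / α)) ≤
        M * ((tailConst α + 1) * ((K:ℝ) + 2) ^ (-(1 - 1 / α)) *
          (((n + 1 + K : ℕ):ℝ) + 1) ^ (1 - 1 / α)) := by
      rw [mul_assoc (tailConst α + 1)]
      gcongr
      linarith
    have h7 : (2:ℝ) ^ K * PopCompFrom β (k + (n + 1)) K G x ≤
        2 ^ K * PopCompFrom β k (n + 1 + K) f x := by gcongr
    rw [one_div, inv_mul_le_iff₀ (by positivity)]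
    linarith

lemma measurable_TcompFrom (β : ℕ → ℝ) (k n : ℕ) : Measurable (TcompFrom β k n) := by
  induction n with
  | zero => exact measurable_id
  | succ n ih => exact (measurable_Tmap _).comp ih

lemma TcompFrom_add (β : ℕ → ℝ) (k n m : ℕ) (x : ℝ) :
    TcompFrom β k (n + m) x = TcompFrom β (k + n) m (TcompFrom β k n x) := by
  induction m with
  | zero => rfl
  | succ m ih => rw [← add_assoc, TcompFrom, TcompFrom, ih, add_assoc k n m]

lemma TcompFrom_congr {β β' : ℕ → ℝ} {n : ℕ} (h : ∀ i, 1 ≤ i → i ≤ n → β i = β' i) (x : ℝ) :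
    TcompFrom β 0 n x = TcompFrom β' 0 n x := by
  induction n with
  | zero => rfl
  | succ n ih =>
    rw [TcompFrom, TcompFrom, ih fun i h1 h2 => h i h1 (h2.trans n.le_succ), h _ (by omega)
      (by omega)]

section Sequence

variable {α M B : ℝ} {β : ℕ → ℝ} {f g Φ : ℝ → ℝ}

lemma TcompFrom_mem_Ioc (hβ : ∀ i, 0 < β i) (k n : ℕ) :
    ∀ x ∈ Ioc (0:ℝ) 1, TcompFrom β k n x ∈ Ioc (0:ℝ) 1 := by
  induction n with
  | zero => exact fun x hx => hx
  | succ n ih => exact fun x hx => Tmap_mem_Ioc (hβ _) (ih x hx)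

lemma TameDensity.setIntegral_popCompFrom_mul (hα1 : α < 1) (hβ : ∀ i, β i ∈ Ioc 0 α)
    (hf : TameDensity α M f) (k n : ℕ) (hΦ : Measurable Φ)
    (hB : ∀ x ∈ Ioc (0:ℝ) 1, |Φ x| ≤ B) :
    ∫ x in Ioc 0 1, PopCompFrom β k n f x * Φ x =
      ∫ x in Ioc 0 1, f x * Φ (TcompFrom β k n x) := by
  have hβ1 := mem_Ioc_one hα1 hβ
  induction n generalizing Φ with
  | zero => rfl
  | succ n ih =>
    simp only [PopCompFrom, TcompFrom]
    rw [setIntegral_Pop_mul (hβ1 _) (hf.popCompFrom hα1 hβ k n).1.int hΦ hB]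
    exact ih (hΦ.comp (measurable_Tmap _)) fun x hx => hB _ (Tmap_mem_Ioc (hβ _).1 hx)

lemma DecreasingDensity.abs_setIntegral_mul_le (hf : DecreasingDensity f)
    (hB : ∀ x ∈ Ioc (0:ℝ) 1, |Φ x| ≤ B) :
    |∫ x in Ioc 0 1, f x * Φ x| ≤ mInt f * B := by
  have hfB : Integrable (fun x => f x * B) (volume.restrict (Ioc 0 1)) := hf.int.mul_const B
  rw [mInt, ← integral_mul_const, ← Real.norm_eq_abs]
  refine norm_integral_le_of_norm_le hfB
    ((ae_restrict_iff' measurableSet_Ioc).2 (ae_of_all _ fun x hx => ?_))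
  rw [Real.norm_eq_abs, abs_mul, abs_of_nonneg (hf.nonneg x hx)]
  exact mul_le_mul_of_nonneg_left (hB x hx) (hf.nonneg x hx)

/-- After `j` blocks of length `N`, the difference of two densities of equal mass is the
difference of two tame densities of exponentially small mass, up to an error `M η`. -/
lemma exists_tame_after_blocks {γ η : ℝ} {N : ℕ} (hα1 : α < 1) (hβ : ∀ i, β i ∈ Ioc 0 α)
    (hγ0 : 0 < γ) (hγ1 : γ < 1) (hη : 0 ≤ η)
    (hlow : ∀ (k : ℕ) (f : ℝ → ℝ), TameDensity α M f → ∀ x ∈ Ioc (0:ℝ) 1,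
      γ * (mInt f - M * η) ≤ PopCompFrom β k N f x)
    (hf : TameDensity α M f) (hg : TameDensity α M g) (hfg : mInt f = mInt g) (j : ℕ) :
    ∃ u v : ℝ → ℝ, TameDensity α M u ∧ TameDensity α M v ∧ mInt u = mInt v ∧
      mInt u - M * η ≤ (1 - γ) ^ j * M ∧
      ∀ (Φ : ℝ → ℝ) (B : ℝ), Measurable Φ → (∀ x ∈ Ioc (0:ℝ) 1, |Φ x| ≤ B) →
        (∫ x in Ioc 0 1, f x * Φ (TcompFrom β 0 (j * N) x)) -
          (∫ x in Ioc 0 1, g x * Φ (TcompFrom β 0 (j * N) x)) =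
        (∫ x in Ioc 0 1, u x * Φ x) - ∫ x in Ioc 0 1, v x * Φ x := by
  have hM := hf.nonneg_bound
  induction j with
  | zero =>
    refine ⟨f, g, hf, hg, hfg, ?_, fun Φ B _ _ => by simp [TcompFrom]⟩
    have := hf.mass
    have := mul_nonneg hM hη
    simp only [pow_zero]
    linarith
  | succ j ih =>
    obtain ⟨u, v, hu, hv, huv, hmass, hint⟩ := ih
    set c : ℝ := γ * max 0 (mInt u - M * η) with hc
    have hc0 : 0 ≤ c := mul_nonneg hγ0.le (le_max_left _ _)
    obtain ⟨hPu, hPum⟩ := hu.popCompFrom hα1 hβ (j * N) N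
    obtain ⟨hPv, hPvm⟩ := hv.popCompFrom hα1 hβ (j * N) N
    have hcu : ∀ x ∈ Ioc (0:ℝ) 1, c ≤ PopCompFrom β (j * N) N u x := by
      intro x hx
      rw [hc, mul_max_of_nonneg _ _ hγ0.le, mul_zero]
      exact max_le (hPu.nonneg x hx) (hlow _ u hu x hx)
    have hcv : ∀ x ∈ Ioc (0:ℝ) 1, c ≤ PopCompFrom β (j * N) N v x := by
      intro x hx
      rw [hc, mul_max_of_nonneg _ _ hγ0.le, mul_zero, huv]
      exact max_le (hPv.nonneg x hx) (hlow _ v hv x hx)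
    obtain ⟨hu', hum'⟩ := hPu.sub_const hc0 hcu
    obtain ⟨hv', hvm'⟩ := hPv.sub_const hc0 hcv
    refine ⟨_, _, hu', hv', ?_, ?_, fun Φ B hΦ hB => ?_⟩
    · rw [hum', hvm', hPum, hPvm, huv]
    · rw [hum', hPum, hc, pow_succ]
      have hpow : 0 ≤ (1 - γ) ^ j * M := mul_nonneg (pow_nonneg (by linarith) _) hM
      rcases le_total 0 (mInt u - M * η) with h | h
      · rw [max_eq_right h]
        nlinarith
      · rw [max_eq_left h]
        nlinarith
    · have hcΦ := integrableOn_mul_of_bounded (f := fun _ => c) (by simp) hΦ hB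
      have key : ∀ w : ℝ → ℝ, TameDensity α M w →
          ∫ x in Ioc 0 1, (PopCompFrom β (j * N) N w x - c) * Φ x =
            (∫ x in Ioc 0 1, w x * Φ (TcompFrom β (j * N) N x)) - ∫ x in Ioc 0 1, c * Φ x := by
        intro w hw
        simp only [sub_mul]
        rw [integral_sub (integrableOn_mul_of_bounded (hw.popCompFrom hα1 hβ _ _).1.int hΦ hB) hcΦ,
          hw.setIntegral_popCompFrom_mul hα1 hβ _ _ hΦ hB]
      rw [key u hu, key v hv, sub_sub_sub_cancel_right]
      rw [← hint (fun x => Φ (TcompFrom β (j * N) N x)) B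
        (hΦ.comp (measurable_TcompFrom _ _ _))
        fun x hx => hB _ (TcompFrom_mem_Ioc (fun i => (hβ i).1) _ _ x hx)]
      simp only [Nat.succ_mul, TcompFrom_add, zero_add]

lemma abs_integral_sub_le_of_blocks {γ η : ℝ} {N : ℕ} (hα1 : α < 1) (hβ : ∀ i, β i ∈ Ioc 0 α)
    (hγ0 : 0 < γ) (hγ1 : γ < 1) (hη : 0 ≤ η)
    (hlow : ∀ (k : ℕ) (f : ℝ → ℝ), TameDensity α M f → ∀ x ∈ Ioc (0:ℝ) 1,
      γ * (mInt f - M * η) ≤ PopCompFrom β k N f x)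
    (hf : TameDensity α M f) (hg : TameDensity α M g) (hfg : mInt f = mInt g) {j n : ℕ}
    (hn : j * N ≤ n) (hΦ : Measurable Φ) (hB : ∀ x ∈ Ioc (0:ℝ) 1, |Φ x| ≤ B) :
    |(∫ x in Ioc 0 1, f x * Φ (TcompFrom β 0 n x)) -
        ∫ x in Ioc 0 1, g x * Φ (TcompFrom β 0 n x)| ≤ 2 * B * M * (η + (1 - γ) ^ j) := by
  obtain ⟨r, rfl⟩ := Nat.exists_eq_add_of_le hn
  obtain ⟨u, v, hu, hv, huv, hmass, hint⟩ :=
    exists_tame_after_blocks hα1 hβ hγ0 hγ1 hη hlow hf hg hfg j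
  have hB0 : 0 ≤ B := (abs_nonneg _).trans (hB 1 (by simp))
  have hB' : ∀ x ∈ Ioc (0:ℝ) 1, |Φ (TcompFrom β (j * N) r x)| ≤ B :=
    fun x hx => hB _ (TcompFrom_mem_Ioc (fun i => (hβ i).1) _ _ x hx)
  have h := hint (fun x => Φ (TcompFrom β (j * N) r x)) B
    (hΦ.comp (measurable_TcompFrom _ _ _)) hB'
  simp only [TcompFrom_add, zero_add]
  rw [h]
  have h1 := hu.toDecreasingDensity.abs_setIntegral_mul_le hB'
  have h2 := hv.toDecreasingDensity.abs_setIntegral_mul_le hB'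
  rw [← huv] at h2
  refine (abs_sub _ _).trans ?_
  nlinarith

end Sequence

/-- The number of blocks is chosen of order `log n`. -/
lemma exists_block_length {α γ C : ℝ} (hα0 : 0 < α) (hα1 : α < 1) (hγ0 : 0 < γ) (hγ1 : γ < 1)
    (hC : 0 < C) : ∃ D > 0, ∀ n : ℕ, 1 < n → ∃ j N : ℕ, j * N ≤ n ∧
      C * ((N:ℝ) + 1) ^ (1 - 1 / α) + (1 - γ) ^ j ≤
        D * (n:ℝ) ^ (1 - 1 / α) * (Real.log n) ^ (1 / α) := by
  have he := one_sub_one_div_neg hα0 hα1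
  have hg : Real.log (1 - γ) < 0 := Real.log_neg (by linarith) (by linarith)
  have hl2 : 0 < Real.log 2 := Real.log_pos (by norm_num)
  obtain ⟨A, hA⟩ : ∃ A, A = (1 - 1 / α) / Real.log (1 - γ) := ⟨_, rfl⟩
  have hA0 : 0 < A := hA ▸ div_pos_of_neg_of_neg he hg
  refine ⟨(C + 1) * (A + 1 / Real.log 2) ^ (1 / α), by positivity, fun n hn => ?_⟩
  have hn2 : (2:ℝ) ≤ n := by exact_mod_cast hn
  have hn0 : (0:ℝ) < n := by linarith
  have hln : Real.log 2 ≤ Real.log n := Real.log_le_log (by norm_num) hn2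
  have hln0 : 0 < Real.log n := hl2.trans_le hln
  set j := ⌈A * Real.log n⌉₊ with hj
  have hjpos : 0 < j := Nat.ceil_pos.2 (by positivity)
  have hj1 : (1:ℝ) ≤ j := by exact_mod_cast hjpos
  have hjA : A * Real.log n ≤ j := Nat.le_ceil _
  have hjB : (j:ℝ) ≤ (A + 1 / Real.log 2) * Real.log n := by
    have h1 : (j:ℝ) < A * Real.log n + 1 := Nat.ceil_lt_add_one (by positivity)
    have h2 : 1 ≤ 1 / Real.log 2 * Real.log n := by
      rw [one_div, ← div_eq_inv_mul, le_div_iff₀ hl2]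
      linarith
    linarith
  refine ⟨j, n / j, Nat.mul_div_le n j, ?_⟩
  have hJ : (j:ℝ) ^ (1 / α) ≤ (A + 1 / Real.log 2) ^ (1 / α) * (Real.log n) ^ (1 / α) := by
    rw [← Real.mul_rpow (by positivity) hln0.le]
    exact Real.rpow_le_rpow (by positivity) hjB (by positivity)
  have hJ1 : 1 ≤ (j:ℝ) ^ (1 / α) := Real.one_le_rpow hj1 (by positivity)
  have hne : 0 < (n:ℝ) ^ (1 - 1 / α) := by positivity
  have hfirst : (((n / j : ℕ):ℝ) + 1) ^ (1 - 1 / α) ≤ (n:ℝ) ^ (1 - 1 / α) * (j:ℝ) ^ (1 / α) := by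
    have h1 : (n:ℝ) / j ≤ ((n / j : ℕ):ℝ) + 1 := by
      rw [div_le_iff₀ (by positivity)]
      have := (Nat.lt_div_mul_add (a := n) hjpos).le
      have h2 : (n:ℝ) ≤ ((n / j : ℕ):ℝ) * j + j := by exact_mod_cast this
      linarith
    refine (Real.rpow_le_rpow_of_nonpos (by positivity) h1 he.le).trans ?_
    rw [Real.div_rpow hn0.le (by positivity), div_eq_mul_inv, ← Real.rpow_neg (by positivity)]
    gcongr
    linarith
  have hsecond : (1 - γ) ^ j ≤ (n:ℝ) ^ (1 - 1 / α) := by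
    rw [← Real.rpow_natCast, Real.rpow_def_of_pos (by linarith), Real.rpow_def_of_pos hn0]
    apply Real.exp_le_exp.2
    have h1 : Real.log (1 - γ) * A = 1 - 1 / α := by
      rw [hA, mul_div_cancel₀ _ hg.ne]
    calc Real.log (1 - γ) * j ≤ Real.log (1 - γ) * (A * Real.log n) :=
          mul_le_mul_of_nonpos_left hjA hg.le
      _ = Real.log n * (1 - 1 / α) := by rw [← h1]; ring
  calc C * (((n / j : ℕ):ℝ) + 1) ^ (1 - 1 / α) + (1 - γ) ^ j
      ≤ C * ((n:ℝ) ^ (1 - 1 / α) * (j:ℝ) ^ (1 / α)) +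
          (n:ℝ) ^ (1 - 1 / α) * (j:ℝ) ^ (1 / α) := by
        gcongr
        exact hsecond.trans (le_mul_of_one_le_right hne.le hJ1)
    _ = (C + 1) * ((n:ℝ) ^ (1 - 1 / α) * (j:ℝ) ^ (1 / α)) := by ring
    _ ≤ (C + 1) * ((n:ℝ) ^ (1 - 1 / α) *
          ((A + 1 / Real.log 2) ^ (1 / α) * (Real.log n) ^ (1 / α))) := by gcongr
    _ = _ := by ring

lemma abs_le_iSup_Icc {h : ℝ → ℝ} (hc : Continuous h) {x : ℝ} (hx : x ∈ Icc (0:ℝ) 1) :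
    |h x| ≤ ⨆ y : Icc (0:ℝ) 1, |h (y:ℝ)| :=
  le_ciSup (f := fun y : Icc (0:ℝ) 1 => |h (y:ℝ)|)
    (isCompact_range (by fun_prop)).bddAbove ⟨x, hx⟩

/-- A `C¹` function and its mean are, up to a common summand, decreasing bounded densities. -/
lemma exists_tame_decomposition {α : ℝ} (hα0 : 0 < α) (hα1 : α < 1) {ψ : ℝ → ℝ}
    (hψ : ContDiff ℝ 1 ψ) : ∃ w : ℝ → ℝ, Continuous w ∧
      TameDensity α (2 * C1norm ψ) (fun x => ψ x + w x) ∧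
      TameDensity α (2 * C1norm ψ) (fun x => mInt ψ + w x) := by
  have hc := hψ.continuous
  have hS : ∀ x ∈ Icc (0:ℝ) 1, |ψ x| ≤ _ := fun x hx => abs_le_iSup_Icc hc hx
  have hK : ∀ x ∈ Icc (0:ℝ) 1, |deriv ψ x| ≤ _ :=
    fun x hx => abs_le_iSup_Icc (hψ.continuous_deriv le_rfl) hx
  have hC : C1norm ψ = (⨆ x : Icc (0:ℝ) 1, |ψ (x:ℝ)|) + ⨆ x : Icc (0:ℝ) 1, |deriv ψ (x:ℝ)| := rfl
  set S := ⨆ x : Icc (0:ℝ) 1, |ψ (x:ℝ)|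
  set K := ⨆ x : Icc (0:ℝ) 1, |deriv ψ (x:ℝ)|
  have hK0 : 0 ≤ K := (abs_nonneg _).trans (hK 0 (by simp))
  have hm : |mInt ψ| ≤ S := by
    have := norm_setIntegral_le_of_norm_le_const (μ := volume) (s := Ioc (0:ℝ) 1) (f := ψ) (C := S)
      (by simp) fun x hx => hS x (Ioc_subset_Icc_self hx)
    simpa [mInt] using this
  have hlip : ∀ x ∈ Icc (0:ℝ) 1, ∀ y ∈ Icc (0:ℝ) 1, x ≤ y → ψ y - ψ x ≤ K * (y - x) := by
    intro x hx y hy hxy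
    have := (convex_Icc (0:ℝ) 1).norm_image_sub_le_of_norm_deriv_le
      (fun z _ => (hψ.differentiable one_ne_zero).differentiableAt) hK hx hy
    rw [Real.norm_eq_abs, Real.norm_eq_abs, abs_of_nonneg (sub_nonneg.2 hxy)] at this
    exact (le_abs_self _).trans this
  refine ⟨fun x => K * (1 - x) + S, by fun_prop, ?_, ?_⟩
  · refine .of_le hα0 hα1 ⟨fun x hx y hy hxy => ?_, fun x hx => ?_,
      Continuous.integrableOn_Ioc (by fun_prop)⟩ fun x hx => ?_
    · have := hlip x (Ioc_subset_Icc_self hx) y (Ioc_subset_Icc_self hy) hxy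
      simp only
      linarith
    · have := abs_le.1 (hS x (Ioc_subset_Icc_self hx))
      have := mul_nonneg hK0 (sub_nonneg.2 hx.2)
      linarith
    · have := abs_le.1 (hS x (Ioc_subset_Icc_self hx))
      nlinarith [hx.1]
  · refine .of_le hα0 hα1 ⟨fun x hx y hy hxy => ?_, fun x hx => ?_,
      Continuous.integrableOn_Ioc (by fun_prop)⟩ fun x hx => ?_
    · simp only
      gcongr
    · have := abs_le.1 hm
      have := mul_nonneg hK0 (sub_nonneg.2 hx.2)
      linarith
    · have := abs_le.1 hm
      nlinarith [hx.1]

/-- Decay of non-stationary correlations: there exist a constant `C_α > 0`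
and an affine function `F(t) = p t + q` such that for every bounded measurable `φ`
(with bound `B` on `[0,1]`), every `ψ ∈ C¹(S¹)`, every `n > 1` and every sequence
`β₁, …, β_n ∈ (0,α]`,
`|∫ ψ ⬝ (φ ∘ T_{β_n} ∘ ⋯ ∘ T_{β_1}) dm - (∫ ψ dm)(∫ φ ∘ T_{β_n} ∘ ⋯ ∘ T_{β_1} dm)|
  ≤ C_α B F(‖ψ‖_{C¹}) n^(1-1/α) (log n)^(1/α)`. -/
theorem decay_of_nonstationary_correlations (α : ℝ) (hα0 : 0 < α) (hα1 : α < 1) :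
    ∃ C > 0, ∃ p q : ℝ, ∀ φ ψ : ℝ → ℝ, ∀ B : ℝ,
      Measurable φ → (∀ x ∈ Set.Icc (0:ℝ) 1, |φ x| ≤ B) →
      ContDiff ℝ 1 ψ → Function.Periodic ψ 1 →
      ∀ n : ℕ, 1 < n → ∀ β : ℕ → ℝ, (∀ i, 1 ≤ i → i ≤ n → β i ∈ Set.Ioc (0:ℝ) α) →
      |(∫ x in Set.Ioc (0:ℝ) 1, ψ x * φ (TcompFrom β 0 n x)) -
          (∫ x in Set.Ioc (0:ℝ) 1, ψ x) * ∫ x in Set.Ioc (0:ℝ) 1, φ (TcompFrom β 0 n x)|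
        ≤ C * B * (p * C1norm ψ + q) * (n:ℝ)^(1-1/α) * (Real.log n)^(1/α) := by
  obtain ⟨γ, hγ0, hγ1, C, hC, hlow⟩ := exists_uniform_lower_bound hα0 hα1
  obtain ⟨D, hD, hblock⟩ := exists_block_length hα0 hα1 hγ0 hγ1 hC
  refine ⟨4 * D, by positivity, 1, 0, fun φ ψ B hφ hB hψ _ n hn β hβ => ?_⟩
  obtain ⟨j, N, hjN, hle⟩ := hblock n hn
  obtain ⟨w, hw, hf, hg⟩ := exists_tame_decomposition hα0 hα1 hψ
  let β' : ℕ → ℝ := fun i => if 1 ≤ i ∧ i ≤ n then β i else α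
  have hβ' : ∀ i, β' i ∈ Ioc 0 α := by
    intro i
    by_cases h : 1 ≤ i ∧ i ≤ n
    · simpa only [β', if_pos h] using hβ i h.1 h.2
    · simpa only [β', if_neg h] using ⟨hα0, le_rfl⟩
  simp only [TcompFrom_congr (β := β) (β' := β') (n := n)
    fun i h1 h2 => (if_pos (⟨h1, h2⟩ : 1 ≤ i ∧ i ≤ n)).symm]
  have hB' : ∀ x ∈ Ioc (0:ℝ) 1, |φ x| ≤ B := fun x hx => hB x (Ioc_subset_Icc_self hx)
  have hB0 : 0 ≤ B := (abs_nonneg _).trans (hB' 1 (by simp))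
  have hψi : IntegrableOn ψ (Ioc 0 1) := hψ.continuous.integrableOn_Ioc
  have hwi : IntegrableOn w (Ioc 0 1) := hw.integrableOn_Ioc
  have hmass : mInt (fun x => ψ x + w x) = mInt (fun x => mInt ψ + w x) := by
    rw [mInt, mInt, integral_add hψi hwi, integral_add (by simp) hwi]
    simp [mInt]
  have h := abs_integral_sub_le_of_blocks hα1 hβ' hγ0 hγ1
    (by positivity : 0 ≤ C * ((N:ℝ) + 1) ^ (1 - 1 / α))
    (fun k f hf => hlow β' hβ' k N _ f hf) hf hg hmass hjN hφ hB'
  have hΦm : Measurable fun x => φ (TcompFrom β' 0 n x) := hφ.comp (measurable_TcompFrom _ _ _)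
  have hΦB : ∀ x ∈ Ioc (0:ℝ) 1, |φ (TcompFrom β' 0 n x)| ≤ B :=
    fun x hx => hB' _ (TcompFrom_mem_Ioc (fun i => (hβ' i).1) _ _ x hx)
  have hwΦ := integrableOn_mul_of_bounded hwi hΦm hΦB
  have hcΦ := integrableOn_mul_of_bounded (f := fun _ => mInt ψ) (by simp) hΦm hΦB
  simp only [add_mul] at h
  rw [integral_add (integrableOn_mul_of_bounded hψi hΦm hΦB) hwΦ, integral_add hcΦ hwΦ,
    add_sub_add_right_eq_sub, integral_const_mul] at h
  refine h.trans ?_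
  calc 2 * B * (2 * C1norm ψ) * (C * ((N:ℝ) + 1) ^ (1 - 1 / α) + (1 - γ) ^ j)
      ≤ 2 * B * (2 * C1norm ψ) * (D * (n:ℝ) ^ (1 - 1 / α) * (Real.log n) ^ (1 / α)) :=
        mul_le_mul_of_nonneg_left hle (mul_nonneg (by positivity) hf.nonneg_bound)
    _ = _ := by ring
end

section
/- Fix 0 < α < 1 and a > 2^α(2+α)/(1−α) (in particular a > 1). For every ψ ∈ C¹(S¹) there exist real numbers λ and ν, depending affinely on ‖ψ‖_{C¹}, such that the function x ↦ ψ(x) + λ x + ν belongs to the cone C₂; explicitly, this holds whenever λ < −‖ψ'‖_∞ and ν > max{ ((1+α)‖ψ‖_∞ + ‖ψ'‖_∞ − λ(2+α))/(1+α), ((1+a)/(a−1))‖ψ‖_∞ − aλ/(2(a−1)) }. -/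
open MeasureTheory Set

/-- A continuous function on `ℝ` is bounded on `[0,1]` by the supremum of its absolute value. -/
theorem abs_le_iSup_Icc_s10 {g : ℝ → ℝ} (hg : Continuous g) {x : ℝ} (hx : x ∈ Set.Icc (0:ℝ) 1) :
    |g x| ≤ ⨆ y : Set.Icc (0:ℝ) 1, |g (y:ℝ)| := by
  have hc : Continuous fun y : Set.Icc (0:ℝ) 1 => |g (y:ℝ)| := by fun_prop
  exact le_ciSup (isCompact_range hc).bddAbove (⟨x, hx⟩ : Set.Icc (0:ℝ) 1)

/-- The constraint on `a` forces `1 < a`. -/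
theorem one_lt_of_cone_parameter {α a : ℝ} (hα0 : 0 < α) (hα1 : α < 1)
    (ha : (2:ℝ)^α * (2+α) / (1-α) < a) : 1 < a := by
  refine lt_of_le_of_lt ?_ ha
  have h2 : (1:ℝ) ≤ 2^α := Real.one_le_rpow (by norm_num) hα0.le
  rw [le_div_iff₀ (by linarith)]
  nlinarith

/-- A nonnegative differentiable `f` whose derivative satisfies `0 ≤ (α+1) f x + x f' x`
makes `x ↦ x^(α+1) f x` increasing. -/
theorem monotoneOn_rpow_mul {α : ℝ} {f f' : ℝ → ℝ} (hf : ∀ x, HasDerivAt f (f' x) x)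
    (h : ∀ x ∈ Set.Ioo (0:ℝ) 1, 0 ≤ (α+1) * f x + x * f' x) :
    MonotoneOn (fun x : ℝ => x^(α+1) * f x) (Set.Ioc 0 1) := by
  have hd : ∀ x : ℝ, 0 < x → HasDerivAt (fun x : ℝ => x^(α+1) * f x)
      (x^α * ((α+1) * f x + x * f' x)) x := by
    intro x hx
    refine ((Real.hasDerivAt_rpow_const (p := α+1) (Or.inl hx.ne')).mul (hf x)).congr_deriv ?_
    rw [Real.rpow_add_one hx.ne', add_sub_cancel_right]
    ring
  refine monotoneOn_of_hasDerivWithinAt_nonneg (convex_Ioc 0 1)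
    (f' := fun x => x^α * ((α+1) * f x + x * f' x))
    (fun x hx => (hd x hx.1).continuousAt.continuousWithinAt) ?_ ?_
  · rw [interior_Ioc]
    exact fun x hx => (hd x hx.1).hasDerivWithinAt
  · rw [interior_Ioc]
    exact fun x hx => mul_nonneg (Real.rpow_nonneg hx.1.le _) (h x hx)

/-- An affine lower bound on `(0,1]` bounds the integral from below. -/
theorem le_mInt_of_affine_le {f : ℝ → ℝ} (hf : Continuous f) {b c : ℝ}
    (h : ∀ x ∈ Set.Ioc (0:ℝ) 1, b * x + c ≤ f x) : b / 2 + c ≤ mInt f := by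
  have hc : Continuous fun x : ℝ => b * x + c := by fun_prop
  have hint : ∫ x in Set.Ioc (0:ℝ) 1, (b * x + c) = b / 2 + c := by
    rw [← intervalIntegral.integral_of_le zero_le_one, intervalIntegral.integral_add
      (Continuous.intervalIntegrable (by fun_prop) _ _) (by simp),
      intervalIntegral.integral_const_mul, integral_id]
    simp
    ring
  rw [← hint]
  exact setIntegral_mono_on hc.integrableOn_Ioc hf.integrableOn_Ioc measurableSet_Ioc h

/-- for `a > 2^α(2+α)/(1-α)` and `ψ ∈ C¹(S¹)`, the function
`x ↦ ψ x + λ x + ν` belongs to `C₂` whenever `λ < -‖ψ'‖_∞` and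
`ν > max {((1+α)‖ψ‖_∞ + ‖ψ'‖_∞ - λ(2+α))/(1+α), ((1+a)/(a-1))‖ψ‖_∞ - aλ/(2(a-1))}`. -/
theorem C1_shifted_into_cone (α a : ℝ) (hα0 : 0 < α) (hα1 : α < 1)
    (ha : (2:ℝ)^α * (2+α) / (1-α) < a)
    (ψ : ℝ → ℝ) (hψ : ContDiff ℝ 1 ψ) (hper : Function.Periodic ψ 1)
    (lam ν : ℝ)
    (hlam : lam < -(⨆ x : Set.Icc (0:ℝ) 1, |deriv ψ (x:ℝ)|))
    (hν : ν > max
      (((1+α) * (⨆ x : Set.Icc (0:ℝ) 1, |ψ (x:ℝ)|) +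
          (⨆ x : Set.Icc (0:ℝ) 1, |deriv ψ (x:ℝ)|) - lam*(2+α)) / (1+α))
      ((1+a)/(a-1) * (⨆ x : Set.Icc (0:ℝ) 1, |ψ (x:ℝ)|) - a*lam/(2*(a-1)))) :
    memC2 α a (fun x => ψ x + lam * x + ν) := by
  have hb := fun x (hx : x ∈ Set.Icc (0:ℝ) 1) => abs_le.mp (abs_le_iSup_Icc_s10 hψ.continuous hx)
  have hb' := fun x (hx : x ∈ Set.Icc (0:ℝ) 1) =>
    abs_le.mp (abs_le_iSup_Icc_s10 (hψ.continuous_deriv le_rfl) hx)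
  have hD0 : 0 ≤ ⨆ x : Set.Icc (0:ℝ) 1, |deriv ψ (x:ℝ)| :=
    Real.iSup_nonneg fun _ => abs_nonneg _
  have hM0 : 0 ≤ ⨆ x : Set.Icc (0:ℝ) 1, |ψ (x:ℝ)| := Real.iSup_nonneg fun _ => abs_nonneg _
  generalize (⨆ x : Set.Icc (0:ℝ) 1, |deriv ψ (x:ℝ)|) = D at *
  generalize (⨆ x : Set.Icc (0:ℝ) 1, |ψ (x:ℝ)|) = M at *
  have ha1 : 1 < a := one_lt_of_cone_parameter hα0 hα1 ha
  have hν₁ : (1+α) * M + D - lam*(2+α) < ν * (1+α) :=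
    (div_lt_iff₀ (by linarith)).mp ((le_max_left _ _).trans_lt hν)
  have hν₂ : (1+a) * M - a*lam/2 < ν * (a-1) := by
    refine (div_lt_iff₀ (sub_pos.mpr ha1)).mp (lt_of_eq_of_lt ?_ ((le_max_right _ _).trans_lt hν))
    have : a - 1 ≠ 0 := (sub_pos.mpr ha1).ne'
    field_simp
  have hd : ∀ x, HasDerivAt (fun x => ψ x + lam * x + ν) (deriv ψ x + lam) x := by
    intro x
    simpa using (((hψ.differentiable one_ne_zero x).hasDerivAt).add
      ((hasDerivAt_id x).const_mul lam)).add_const ν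
  have hcont : Continuous fun x => ψ x + lam * x + ν :=
    continuous_iff_continuousAt.mpr fun x => (hd x).continuousAt
  have hlow : 0 ≤ lam + (ν - M) := by nlinarith
  refine ⟨⟨hcont.continuousOn, fun x hx => ?_, ?_, ?_⟩, hcont.integrableOn_Ioc, fun x hx => ?_⟩
  · nlinarith [(hb x ⟨hx.1.le, hx.2⟩).1, hx.2]
  · refine antitoneOn_of_hasDerivWithinAt_nonpos (convex_Ioc 0 1) hcont.continuousOn
      (fun x _ => (hd x).hasDerivWithinAt) fun x hx => ?_
    rw [interior_Ioc] at hx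
    linarith [(hb' x ⟨hx.1.le, hx.2.le⟩).2]
  · refine monotoneOn_rpow_mul hd fun x hx => ?_
    have hx' : x ∈ Set.Icc (0:ℝ) 1 := ⟨hx.1.le, hx.2.le⟩
    have h₁ : 0 ≤ (α+1) * (ψ x + M) := mul_nonneg (by linarith) (by linarith [(hb x hx').1])
    have h₂ : 0 ≤ x * (deriv ψ x + D) := mul_nonneg hx'.1 (by linarith [(hb' x hx').1])
    have h₃ : 0 ≤ (1-x) * (D - lam*(2+α)) :=
      mul_nonneg (by linarith [hx'.2]) (by nlinarith)
    linarith
  · have hI : lam / 2 + (ν - M) ≤ mInt fun x => ψ x + lam * x + ν :=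
      le_mInt_of_affine_le hcont fun y hy => by linarith [(hb y ⟨hy.1.le, hy.2⟩).1]
    have hx1 : 1 ≤ x^(-α) := Real.one_le_rpow_of_pos_of_le_one_of_nonpos hx.1 hx.2 (by linarith)
    calc ψ x + lam * x + ν ≤ M + ν := by nlinarith [(hb x ⟨hx.1.le, hx.2⟩).2, hx.1]
      _ ≤ a * (lam / 2 + (ν - M)) := by linarith
      _ ≤ a * mInt fun x => ψ x + lam * x + ν := by gcongr
      _ ≤ a * x^(-α) * mInt fun x => ψ x + lam * x + ν := by
        gcongr
        · linarith
        · exact le_mul_of_one_le_right (by linarith) hx1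
end

section
/- Fix 0 < α < 1 and let a_n denote the sequence of preimages of 1 under the left branch of T_α, i.e. a_0 = 1 and a_{n+1} ∈ [0, 2/3] satisfies T_α(a_{n+1}) = a_n. Then a_n ≈ n^{−1/α}: there exist constants c₂ ≥ c₁ > 0 (depending on α) such that c₁ n^{−1/α} ≤ a_n ≤ c₂ n^{−1/α} for all n ≥ 1. -/
open MeasureTheory Set

open Real in
theorem one_add_half_mul_le_rpow_one_add {α u : ℝ} (hα0 : 0 < α) (hα1 : α < 1)
    (hu0 : 0 ≤ u) (hu1 : u ≤ 1) : 1 + α * u / 2 ≤ (1 + u) ^ α := by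
  have h1 : (1 + u) ^ (1 - α) ≤ 1 + (1 - α) * u :=
    rpow_one_add_le_one_add_mul_self (by linarith) (by linarith) (by linarith)
  have h2 : (1 + u) ^ α * (1 + u) ^ (1 - α) = 1 + u := by
    rw [← rpow_add (by linarith)]; simp
  have h3 : 0 < (1 + u) ^ α := rpow_pos_of_pos (by linarith) _
  have h4 : 1 + u ≤ (1 + u) ^ α * (1 + (1 - α) * u) := by
    rw [← h2]
    calc (1 + u) ^ α * (1 + u) ^ (1 - α) ≤ (1 + u) ^ α * (1 + (1 - α) * u) := by gcongr
      _ = _ := by rw [h2]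
  have h5 : 0 < 1 + (1 - α) * u := by nlinarith
  refine le_of_mul_le_mul_right (le_trans ?_ h4) h5
  have h6 : 0 ≤ α * u := by positivity
  have h7 : (1 - α) * u ≤ 1 := by nlinarith
  nlinarith

/-- One step of `x ↦ x + K x ^ (1 + α)` changes `x ^ (-α)` by an amount comparable to `K α`. -/
theorem rpow_neg_sub_bounds {α K x : ℝ} (hα0 : 0 < α) (hα1 : α < 1)
    (hK : 0 < K) (hx : 0 < x) (hu : K * x ^ α ≤ 1) :
    K * α / 4 ≤ x ^ (-α) - (x + K * x ^ (1 + α)) ^ (-α) ∧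
      x ^ (-α) - (x + K * x ^ (1 + α)) ^ (-α) ≤ K * α := by
  have hfac : x + K * x ^ (1 + α) = x * (1 + K * x ^ α) := by
    rw [Real.rpow_add hx, Real.rpow_one]; ring
  have ht : 0 < x ^ α := Real.rpow_pos_of_pos hx _
  rw [hfac, Real.mul_rpow hx.le (by positivity), Real.rpow_neg hx.le,
    Real.rpow_neg (by positivity)]
  generalize x ^ α = t at *
  have hlow := one_add_half_mul_le_rpow_one_add hα0 hα1 (by positivity : 0 ≤ K * t) hu
  have hup : (1 + K * t) ^ α ≤ 1 + α * (K * t) :=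
    rpow_one_add_le_one_add_mul_self (by linarith [mul_pos hK ht]) hα0.le hα1.le
  generalize (1 + K * t) ^ α = w at *
  have hau : 0 < α * (K * t) := by positivity
  have hau1 : α * (K * t) ≤ 1 := by nlinarith
  have hw : 0 < w := by linarith
  have heq : t⁻¹ - t⁻¹ * w⁻¹ = (w - 1) / (t * w) := by field_simp
  rw [heq]
  constructor
  · rw [le_div_iff₀ (by positivity)]
    nlinarith
  · rw [div_le_iff₀ (by positivity)]
    nlinarith

/-- the preimages `a_n` of `1` under the left branch of `T_α` satisfy
`a_n ≈ n^(-1/α)`. -/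
theorem preimages_of_one_asymptotics (α : ℝ) (hα0 : 0 < α) (hα1 : α < 1)
    (aseq : ℕ → ℝ) (ha0 : aseq 0 = 1)
    (ha : ∀ n : ℕ, aseq (n+1) ∈ Set.Icc (0:ℝ) (2/3) ∧ Tmap α (aseq (n+1)) = aseq n) :
    ∃ c₁ c₂ : ℝ, 0 < c₁ ∧ c₁ ≤ c₂ ∧
      ∀ n : ℕ, 1 ≤ n →
        c₁ * (n:ℝ)^(-(1/α)) ≤ aseq n ∧ aseq n ≤ c₂ * (n:ℝ)^(-(1/α)) := by
  obtain ⟨K, hKdef⟩ : ∃ K : ℝ, K = (3:ℝ) ^ α / 2 ^ (1 + α) := ⟨_, rfl⟩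
  have hK : 0 < K := by rw [hKdef]; positivity
  have hrec : ∀ n, aseq (n+1) + K * aseq (n+1) ^ (1 + α) = aseq n := fun n ↦ by
    have h := (ha n).2
    rwa [Tmap, if_pos (ha n).1.2, ← hKdef] at h
  have hpos : ∀ n, 0 < aseq n := fun n ↦ by
    induction n with
    | zero => simp [ha0]
    | succ n ih =>
      refine lt_of_le_of_ne (ha n).1.1 fun h0 ↦ ?_
      have h := hrec n
      rw [← h0, Real.zero_rpow (by linarith)] at h
      linarith
  have hend : K * (2 / 3 : ℝ) ^ α ≤ 1 := by
    rw [hKdef, Real.div_rpow (by norm_num) (by norm_num), Real.rpow_add (by norm_num),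
      Real.rpow_one]
    have h3 : (0:ℝ) < 3 ^ α := by positivity
    have h2 : (0:ℝ) < 2 ^ α := by positivity
    field_simp
    norm_num
  have hstep : ∀ n, K * α / 4 ≤ aseq (n+1) ^ (-α) - aseq n ^ (-α) ∧
      aseq (n+1) ^ (-α) - aseq n ^ (-α) ≤ K * α := fun n ↦ by
    rw [← hrec n]
    refine rpow_neg_sub_bounds hα0 hα1 hK (hpos _) (le_trans ?_ hend)
    have := Real.rpow_le_rpow (ha n).1.1 (ha n).1.2 hα0.le
    gcongr
  have hbound : ∀ n : ℕ, 1 + K * α / 4 * n ≤ aseq n ^ (-α) ∧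
      aseq n ^ (-α) ≤ 1 + K * α * n := fun n ↦ by
    induction n with
    | zero => simp [ha0]
    | succ n ih =>
      have := hstep n
      push_cast
      constructor <;> linarith [ih.1, ih.2]
  have hKα : 0 < K * α := by positivity
  have hneg : -(1 / α) ≤ 0 := by simpa using hα0.le
  refine ⟨(1 + K * α) ^ (-(1 / α)), (K * α / 4) ^ (-(1 / α)), by positivity,
    Real.rpow_le_rpow_of_nonpos (by positivity) (by linarith) hneg, fun n hn ↦ ?_⟩
  have hn1 : (1:ℝ) ≤ n := by exact_mod_cast hn
  have hinv : aseq n = (aseq n ^ (-α)) ^ (-(1 / α)) := by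
    rw [← Real.rpow_mul (hpos n).le]
    field_simp
    simp
  have hb : 0 < aseq n ^ (-α) := Real.rpow_pos_of_pos (hpos n) _
  rw [← Real.mul_rpow (by positivity) (by positivity),
    ← Real.mul_rpow (by positivity) (by positivity), hinv]
  exact ⟨Real.rpow_le_rpow_of_nonpos hb (by linarith [(hbound n).2]) hneg,
    Real.rpow_le_rpow_of_nonpos (by positivity) (by linarith [(hbound n).1]) hneg⟩
end

section
/- Fix 0 < α < 1. There exist constants D > 0 and 0 < r < 1, depending only on α, such that for every β ∈ (0, α] and every x in the hyperbolic region H = [a₂⁰, 1] (at which T_β is twice differentiable, i.e. x ≠ 2/3), one has |T_β''(x)|/|T_β'(x)| ≤ D and 1/|T_β'(x)| ≤ r. -/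
open MeasureTheory Set

/-- there are constants `D > 0` and `0 < r < 1`, depending only on `α`,
such that for every `β ∈ (0,α]` and every `x` in the hyperbolic region `H = [a₂⁰,1] = [4/9,1]`
with `x ≠ 2/3`, one has `|T_β''(x)|/|T_β'(x)| ≤ D` and `1/|T_β'(x)| ≤ r`.
(Here `a₂⁰ = 4/9` is the second preimage of `1` under the left branch `x ↦ 3x/2` of `T₀`.) -/
theorem hyperbolic_region_derivative_bounds (α : ℝ) (hα0 : 0 < α) (hα1 : α < 1) :
    ∃ D > 0, ∃ r : ℝ, 0 < r ∧ r < 1 ∧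
      ∀ β ∈ Set.Ioc (0:ℝ) α, ∀ x ∈ Set.Icc (4/9:ℝ) 1, x ≠ 2/3 →
        |Tderiv2 β x| / |Tderiv β x| ≤ D ∧ 1 / |Tderiv β x| ≤ r := by
  have h_term : ∀ β x : ℝ, 0 ≤ x → (3:ℝ)^β / 2^(1+β) * x^β = 1/2 * (3/2*x)^β := by
    intro β x hx
    rw [Real.mul_rpow (by norm_num) hx, Real.div_rpow (by norm_num) (by norm_num),
      Real.rpow_add (by norm_num), Real.rpow_one]
    ring
  refine ⟨9/4, by norm_num, 3/4, by norm_num, by norm_num, ?_⟩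
  rintro β ⟨hβ0, hβα⟩ x ⟨hx1, hx2⟩ -
  have hβ1 : β ≤ 1 := hβα.trans hα1.le
  by_cases hx : x ≤ 2/3
  · have hx0 : 0 < x := by linarith
    have h_upper : (3/2*x)^β ≤ 1 := Real.rpow_le_one (by linarith) (by linarith) hβ0.le
    have h_lower : 2/3 ≤ (3/2*x)^β := by
      have h := Real.rpow_le_rpow_of_exponent_ge (x := 3/2*x) (by linarith) (by linarith) hβ1
      rw [Real.rpow_one] at h
      linarith
    have h1 : Tderiv β x = 1 + 1/2 * (3/2*x)^β * (1+β) := by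
      rw [Tderiv, if_pos hx, ← h_term β x hx0.le]
      ring
    have h2 : Tderiv2 β x = 1/2 * (3/2*x)^β * (1+β) * β / x := by
      rw [Tderiv2, if_pos hx, ← h_term β x hx0.le, Real.rpow_sub hx0, Real.rpow_one]
      ring
    generalize (3/2*x)^β = t at *
    have h1_ge : 4/3 ≤ Tderiv β x := by rw [h1]; nlinarith
    have h2_nonneg : 0 ≤ Tderiv2 β x := by rw [h2]; positivity
    have h2_le : Tderiv2 β x ≤ 9/4 := by
      have h_num : 1/2 * t * (1+β) * β ≤ 1 :=
        calc 1/2 * t * (1+β) * β ≤ 1/2 * 1 * (1+1) * 1 := by gcongr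
          _ = 1 := by norm_num
      rw [h2, div_le_iff₀ hx0]
      linarith
    rw [abs_of_nonneg h2_nonneg, abs_of_pos (by linarith)]
    constructor
    · rw [div_le_iff₀ (by linarith)]
      linarith
    · rw [div_le_iff₀ (by linarith)]
      linarith
  · simp only [Tderiv, Tderiv2, if_neg hx]
    norm_num
end

section
/- (Distortion in the intermittent region via the Koebe principle) Fix 0 < α < 1. There exists a constant c₂ > 0 depending only on α with the following property: for every k ≥ 0, every ℓ ≥ 1, every sequence β_{k+1}, …, β_{k+ℓ} ∈ (0, α], and every interval K contained in I_{ℓ,+}^k := [a_{ℓ+2}^k, a_ℓ^k], one has for all a, b ∈ K: (T_{k+ℓ} ∘ ⋯ ∘ T_{k+1})'(a) / (T_{k+ℓ} ∘ ⋯ ∘ T_{k+1})'(b) ≤ exp{ c₂ |T_{k+ℓ} ∘ ⋯ ∘ T_{k+1}(a) − T_{k+ℓ} ∘ ⋯ ∘ T_{k+1}(b)| }. -/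
open MeasureTheory Set

/-- The relative displacement `c_β x^β` of the left branch: `T_β x = x (1 + leftGap β x)`. -/
noncomputable def leftGap (β x : ℝ) : ℝ := (3:ℝ)^β / 2^(1+β) * x^β

lemma leftGap_pos {β x : ℝ} (hx : 0 < x) : 0 < leftGap β x := by
  unfold leftGap; positivity

lemma leftGap_mono {β x y : ℝ} (hβ : 0 ≤ β) (hx : 0 ≤ x) (hxy : x ≤ y) :
    leftGap β x ≤ leftGap β y := by
  unfold leftGap
  have := Real.rpow_le_rpow hx hxy hβ
  gcongr

lemma leftGap_le {β x : ℝ} (hβ : 0 ≤ β) (hx : 0 ≤ x) (hx' : x ≤ 2/3) :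
    leftGap β x ≤ 1/2 := by
  refine (leftGap_mono hβ hx hx').trans_eq ?_
  unfold leftGap
  rw [Real.div_rpow (by norm_num) (by norm_num), Real.rpow_add (by norm_num), Real.rpow_one]
  have h2 : (0:ℝ) < 2^β := by positivity
  have h3 : (0:ℝ) < 3^β := by positivity
  field_simp

lemma Tmap_eq {β x : ℝ} (hx : 0 < x) (hx' : x ≤ 2/3) :
    Tmap β x = x * (1 + leftGap β x) := by
  rw [Tmap, if_pos hx', leftGap, Real.rpow_add hx, Real.rpow_one]
  ring

lemma Tderiv_eq {β x : ℝ} (hx' : x ≤ 2/3) :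
    Tderiv β x = 1 + (1+β) * leftGap β x := by
  rw [Tderiv, if_pos hx', leftGap]
  ring

lemma Tmap_pos {β x : ℝ} (hx : 0 < x) (hx' : x ≤ 2/3) : 0 < Tmap β x := by
  rw [Tmap_eq hx hx']
  have := leftGap_pos (β := β) hx
  positivity

lemma Tderiv_pos {β x : ℝ} (hβ : 0 < β) (hx : 0 < x) (hx' : x ≤ 2/3) : 0 < Tderiv β x := by
  rw [Tderiv_eq hx']
  have := leftGap_pos (β := β) hx
  positivity

lemma Tmap_mono {β x y : ℝ} (hβ : 0 < β) (hx : 0 < x) (hxy : x ≤ y) (hy : y ≤ 2/3) :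
    Tmap β x ≤ Tmap β y := by
  rw [Tmap_eq hx (hxy.trans hy), Tmap_eq (hx.trans_le hxy) hy]
  have := leftGap_mono hβ.le hx.le hxy
  have := leftGap_pos (β := β) hx
  have := hx.trans_le hxy
  gcongr

lemma Tderiv_mono {β x y : ℝ} (hβ : 0 < β) (hx : 0 < x) (hxy : x ≤ y) (hy : y ≤ 2/3) :
    Tderiv β x ≤ Tderiv β y := by
  rw [Tderiv_eq (hxy.trans hy), Tderiv_eq hy]
  have := leftGap_mono hβ.le hx.le hxy
  gcongr

lemma Tmap_le {β x : ℝ} (hβ : 0 < β) (hx : 0 < x) (hx' : x ≤ 2/3) :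
    Tmap β x ≤ 3/2 * x := by
  rw [Tmap_eq hx hx']
  have := leftGap_le hβ.le hx.le hx'
  nlinarith

/-- On the left branch, `x ↦ x² Tderiv β x / (Tmap β x)²` is nonincreasing. -/
lemma Tderiv_mul_sq_le {β x y : ℝ} (hβ : 0 < β) (hβ1 : β < 1) (hx : 0 < x) (hxy : x ≤ y)
    (hy : y ≤ 2/3) :
    Tderiv β y * (Tmap β x * y)^2 ≤ Tderiv β x * (Tmap β y * x)^2 := by
  rw [Tderiv_eq (hxy.trans hy), Tderiv_eq hy, Tmap_eq hx (hxy.trans hy),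
    Tmap_eq (hx.trans_le hxy) hy]
  have hts := leftGap_mono hβ.le hx.le hxy
  have ht := leftGap_pos (β := β) hx
  set t := leftGap β x
  set s := leftGap β y
  have hs : 0 < s := ht.trans_le hts
  have key : (1 + (1+β)*s) * (1+t)^2 ≤ (1 + (1+β)*t) * (1+s)^2 := by
    have h : 0 ≤ (s - t) * ((1 - β) + (s + t) + (1+β) * (s*t)) := by
      have := sub_nonneg.2 hts
      have := sub_nonneg.2 hβ1.le
      positivity
    linarith
  have := mul_le_mul_of_nonneg_right key (sq_nonneg (x*y))
  linarith

/-- Distortion and monotonicity of a composition of left branches along two ordered orbits which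
stay in `(0, 2/3]`. -/
lemma DcompFrom_distortion {β : ℕ → ℝ} (hβ : ∀ i, 0 < β i) (hβ1 : ∀ i, β i < 1) (k : ℕ)
    {x y : ℝ} (hx : 0 < x) (hxy : x ≤ y) (n : ℕ)
    (hy : ∀ i < n, TcompFrom β k i y ≤ 2/3) :
    0 < TcompFrom β k n x ∧ TcompFrom β k n x ≤ TcompFrom β k n y ∧
      0 < DcompFrom β k n x ∧ DcompFrom β k n x ≤ DcompFrom β k n y ∧
      DcompFrom β k n y * (TcompFrom β k n x * y)^2 ≤
        DcompFrom β k n x * (TcompFrom β k n y * x)^2 := by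
  induction n with
  | zero => simp [TcompFrom, DcompFrom, hx, hxy, mul_comm]
  | succ n ih =>
    obtain ⟨h1, h2, h3, h4, h5⟩ := ih fun i hi => hy i (by omega)
    have h6 := hy n (by omega)
    have hb := hβ (k+n+1)
    have hD : ∀ z, DcompFrom β k (n+1) z =
        DcompFrom β k n z * Tderiv (β (k+n+1)) (TcompFrom β k n z) := fun z => by
      simp only [DcompFrom, Finset.prod_range_succ]
    have q := Tderiv_mul_sq_le hb (hβ1 (k+n+1)) h1 h2 h6
    have d0 := Tderiv_pos hb h1 (h2.trans h6)
    have d1 := Tderiv_mono hb h1 h2 h6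
    refine ⟨Tmap_pos h1 (h2.trans h6), Tmap_mono hb h1 h2 h6, ?_, ?_, ?_⟩
    · rw [hD]; positivity
    · rw [hD, hD]; gcongr; exact h3.le.trans h4
    · rw [hD, hD]
      simp only [TcompFrom]
      generalize TcompFrom β k n x = u at *
      generalize TcompFrom β k n y = v at *
      have hv : 0 < v := h1.trans_le h2
      have := mul_le_mul h5 q (mul_nonneg (d0.le.trans d1) (sq_nonneg _))
        (mul_nonneg h3.le (sq_nonneg _))
      refine le_of_mul_le_mul_right ?_ (show 0 < (u*v)^2 by positivity)
      linarith

section Preimages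

variable {β : ℕ → ℝ} {A : ℕ → ℕ → ℝ}

lemma preimage_ge (hβ : ∀ i, 0 < β i) (hA0 : ∀ k, A k 0 = 1)
    (hA : ∀ k n : ℕ, A k (n+1) ∈ Set.Icc (0:ℝ) (2/3) ∧ Tmap (β (k+1)) (A k (n+1)) = A (k+1) n)
    (n k : ℕ) : (2/3 : ℝ)^n ≤ A k n := by
  induction n generalizing k with
  | zero => simp [hA0]
  | succ n ih =>
    obtain ⟨⟨h0, h1⟩, h2⟩ := hA k n
    have h3 := ih (k+1)
    have h4 : (0:ℝ) < (2/3)^n := by positivity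
    rcases h0.eq_or_lt with h | h
    · rw [← h, Tmap_zero (hβ _)] at h2
      linarith
    · have := Tmap_le (hβ (k+1)) h h1
      rw [pow_succ]
      linarith

lemma preimage_pos (hβ : ∀ i, 0 < β i) (hA0 : ∀ k, A k 0 = 1)
    (hA : ∀ k n : ℕ, A k (n+1) ∈ Set.Icc (0:ℝ) (2/3) ∧ Tmap (β (k+1)) (A k (n+1)) = A (k+1) n)
    (n k : ℕ) : 0 < A k n :=
  lt_of_lt_of_le (by positivity) (preimage_ge hβ hA0 hA n k)

lemma TcompFrom_mem_Icc (hβ : ∀ i, 0 < β i) (hA0 : ∀ k, A k 0 = 1)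
    (hA : ∀ k n : ℕ, A k (n+1) ∈ Set.Icc (0:ℝ) (2/3) ∧ Tmap (β (k+1)) (A k (n+1)) = A (k+1) n)
    (k : ℕ) {x : ℝ} (i m : ℕ) (hx : x ∈ Set.Icc (A k (m+i+2)) (A k (m+i))) :
    TcompFrom β k i x ∈ Set.Icc (A (k+i) (m+2)) (A (k+i) m) := by
  induction i generalizing m with
  | zero => exact hx
  | succ i ih =>
    obtain ⟨h1, h2⟩ := ih (m+1) (by rwa [show m + 1 + i = m + (i+1) by omega])
    have hp := preimage_pos hβ hA0 hA (m+1+2) (k+i)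
    have hle := (hA (k+i) m).1.2
    change Tmap (β (k+i+1)) (TcompFrom β k i x) ∈ Set.Icc (A (k+i+1) (m+2)) (A (k+i+1) m)
    rw [← (hA (k+i) m).2, ← (hA (k+i) (m+2)).2]
    exact ⟨Tmap_mono (hβ _) hp h1 (h2.trans hle), Tmap_mono (hβ _) (hp.trans_le h1) h2 hle⟩

end Preimages

/-- Distortion in the intermittent region, Koebe principle: there is
`c₂ > 0` depending only on `α` such that for every `k ≥ 0`, `ℓ ≥ 1`, every sequence of
`β`'s in `(0,α]` and every interval `K ⊆ I_{ℓ,+}^k = [a_{ℓ+2}^k, a_ℓ^k]`, one has for all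
`a, b ∈ K`:
`(T_{k+ℓ} ∘ ⋯ ∘ T_{k+1})'(a) / (T_{k+ℓ} ∘ ⋯ ∘ T_{k+1})'(b)
  ≤ exp(c₂ |T_{k+ℓ} ∘ ⋯ ∘ T_{k+1}(a) - T_{k+ℓ} ∘ ⋯ ∘ T_{k+1}(b)|)`.
Here `a_0^k = 1` and `a_{n+1}^k ∈ [0,2/3]` is the preimage of `a_n^{k+1}` under the left
branch of `T_{k+1}`. -/
theorem distortion_intermittent_region_Koebe (α : ℝ) (hα0 : 0 < α) (hα1 : α < 1) :
    ∃ c₂ > 0, ∀ β : ℕ → ℝ, (∀ i, β i ∈ Set.Ioc (0:ℝ) α) →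
      ∀ A : ℕ → ℕ → ℝ, (∀ k, A k 0 = 1) →
      (∀ k n : ℕ, A k (n+1) ∈ Set.Icc (0:ℝ) (2/3) ∧ Tmap (β (k+1)) (A k (n+1)) = A (k+1) n) →
      ∀ k ℓ : ℕ, 1 ≤ ℓ → ∀ K : Set ℝ, K ⊆ Set.Icc (A k (ℓ+2)) (A k ℓ) →
      ∀ a ∈ K, ∀ b ∈ K,
        DcompFrom β k ℓ a / DcompFrom β k ℓ b ≤
          Real.exp (c₂ * |TcompFrom β k ℓ a - TcompFrom β k ℓ b|) := by
  refine ⟨9/2, by norm_num, fun β hβ A hA0 hA k ℓ _ K hK a ha b hb => ?_⟩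
  have hβ0 : ∀ i, 0 < β i := fun i => (hβ i).1
  have hβ1 : ∀ i, β i < 1 := fun i => (hβ i).2.trans_lt hα1
  have pos : ∀ x ∈ K, 0 < x := fun x hx =>
    (preimage_pos hβ0 hA0 hA (ℓ+2) k).trans_le (hK hx).1
  have orbit : ∀ x ∈ K, ∀ i < ℓ, TcompFrom β k i x ≤ 2/3 := fun x hx i hi => by
    obtain ⟨m, rfl⟩ : ∃ m, ℓ = m + 1 + i := ⟨ℓ - i - 1, by omega⟩
    exact (TcompFrom_mem_Icc hβ0 hA0 hA k i (m+1) (hK hx)).2.trans (hA (k+i) m).1.2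
  have lower : ∀ x ∈ K, 4/9 ≤ TcompFrom β k ℓ x := fun x hx => by
    have h := (TcompFrom_mem_Icc (x := x) hβ0 hA0 hA k ℓ 0 (by simpa using hK hx)).1
    have := preimage_ge hβ0 hA0 hA 2 (k+ℓ)
    norm_num at this h
    linarith
  rcases le_total a b with hab | hba
  · obtain ⟨-, -, h3, h4, -⟩ :=
      DcompFrom_distortion hβ0 hβ1 k (pos a ha) hab ℓ (orbit b hb)
    calc DcompFrom β k ℓ a / DcompFrom β k ℓ b ≤ 1 := div_le_one_of_le₀ h4 (h3.le.trans h4)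
      _ ≤ _ := Real.one_le_exp (by positivity)
  · obtain ⟨h1, h2, h3, -, h5⟩ :=
      DcompFrom_distortion hβ0 hβ1 k (pos b hb) hba ℓ (orbit a ha)
    have hl := lower b hb
    have hb0 := pos b hb
    have ha0 := pos a ha
    set u := TcompFrom β k ℓ b
    set v := TcompFrom β k ℓ a
    have hv : 0 < v := h1.trans_le h2
    rw [abs_of_nonneg (sub_nonneg.2 h2)]
    have hvu : v / u ≤ Real.exp (9/4 * (v - u)) := by
      have h : v / u ≤ 9/4 * (v - u) + 1 := by
        rw [div_le_iff₀ h1]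
        nlinarith [mul_nonneg (sub_nonneg.2 h2) (sub_nonneg.2 hl)]
      exact h.trans (Real.add_one_le_exp _)
    calc DcompFrom β k ℓ a / DcompFrom β k ℓ b ≤ (v * b)^2 / (u * a)^2 := by
          rw [div_le_div_iff₀ h3 (by positivity)]
          linarith
      _ ≤ (v * a)^2 / (u * a)^2 := by gcongr
      _ = (v / u)^2 := by field_simp
      _ ≤ Real.exp (9/4 * (v - u))^2 := by gcongr
      _ = Real.exp (9/2 * (v - u)) := by
          rw [← Real.exp_nat_mul]
          congr 1
          push_cast
          ring
end
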